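/- Let μ ∈ 𝓜 and suppose its distribution function α(s) = μ([0,s]) is continuous on [0,1]. Then each of the functions Φ_μ, ∂_x Φ_μ and ∂_{xx} Φ_μ belongs to C^{1,2}([0,1]×ℝ) (i.e., has continuous partial derivative in s and continuous second partial derivative in x), and Φ_μ is a classical solution of the Parisi PDE: ∂_s Φ_μ(s,x) = −(ζ(s)/2)( ∂_{xx} Φ_μ(s,x) + α(s) (∂_x Φ_μ(s,x))² ) for all (s,x) ∈ [0,1)×ℝ, with terminal condition Φ_μ(1,x) = log cosh x. -/

import Mathlib

open MeasureTheory ProbabilityTheory Real Set Filter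

noncomputable section

/-- `ξ(s) = ∑_{p≥2} β_p² s^p` (we use `β : ℕ → ℝ` with `β 0 = β 1 = 0`). -/
def xiFn (β : ℕ → ℝ) (s : ℝ) : ℝ := ∑' p : ℕ, β p ^ 2 * s ^ p

/-- `ξ'(s)`. -/
def xiD (β : ℕ → ℝ) (s : ℝ) : ℝ := ∑' p : ℕ, (p : ℝ) * β p ^ 2 * s ^ (p - 1)

/-- `ζ(s) = ξ''(s)`. -/
def zetaFn (β : ℕ → ℝ) (s : ℝ) : ℝ :=
  ∑' p : ℕ, (p : ℝ) * ((p : ℝ) - 1) * β p ^ 2 * s ^ (p - 2)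

/-- admissible sequence of temperature parameters -/
def ValidBeta (β : ℕ → ℝ) : Prop :=
  β 0 = 0 ∧ β 1 = 0 ∧ (∀ p, 0 ≤ β p) ∧ (∃ p, 2 ≤ p ∧ 0 < β p) ∧
    Summable fun p : ℕ => (2 : ℝ) ^ p * β p ^ 2

/-- membership in `𝓜`: a Borel probability measure concentrated on `[0,1]` -/
def MemM (μ : Measure ℝ) : Prop := IsProbabilityMeasure μ ∧ μ (Icc (0 : ℝ) 1)ᶜ = 0

/-- member of `𝓜_d`: finitely supported -/
def FinSupp (μ : Measure ℝ) : Prop := ∃ S : Finset ℝ, μ ((S : Set ℝ))ᶜ = 0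

/-- the distribution function `α(s) = μ([0,s])` -/
def distF (μ : Measure ℝ) (s : ℝ) : ℝ := (μ (Icc 0 s)).toReal

/-- the metric `d(μ,ν) = ∫_0^1 |μ([0,s]) - ν([0,s])| ds` -/
def dM (μ ν : Measure ℝ) : ℝ := ∫ s in (0 : ℝ)..1, |distF μ s - distF ν s|

/-- the smallest atom of `μ` strictly after `s` (or `1` if there is none) -/
def nextPt (μ : Measure ℝ) (s : ℝ) : ℝ :=
  sInf ({q : ℝ | s < q ∧ q ≤ 1 ∧ μ {q} ≠ 0} ∪ {1})

/-- one step of the backward recursion defining the Parisi PDE solution: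
`(1/m) log E exp (m Φ(t, x + z √(ξ'(t) - ξ'(s))))`, interpreted as
`E Φ(t, x + z √(ξ'(t) - ξ'(s)))` when `m = 0`. -/
def gStep (β : ℕ → ℝ) (Φ : ℝ → ℝ → ℝ) (m t s x : ℝ) : ℝ :=
  if m = 0 then ∫ z, Φ t (x + z * Real.sqrt (xiD β t - xiD β s)) ∂(gaussianReal 0 1)
  else m⁻¹ * Real.log
    (∫ z, Real.exp (m * Φ t (x + z * Real.sqrt (xiD β t - xiD β s))) ∂(gaussianReal 0 1))

/-- `Φ` is the Parisi PDE solution of a finitely supported `μ`. -/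
def IsAtomicSol (β : ℕ → ℝ) (μ : Measure ℝ) (Φ : ℝ → ℝ → ℝ) : Prop :=
  (∀ x : ℝ, Φ 1 x = Real.log (Real.cosh x)) ∧
  (∀ s ∈ Ico (0 : ℝ) 1, ∀ x : ℝ, Φ s x = gStep β Φ (distF μ s) (nextPt μ s) s x)

/-- `Φ` is the Parisi family `μ ↦ Φ_μ`: it satisfies the backward recursion on `𝓜_d`
and is `d`-continuous on `𝓜` (uniformly in `(s,x) ∈ [0,1] × ℝ`). -/
def IsParisiFamily (β : ℕ → ℝ) (Φ : Measure ℝ → ℝ → ℝ → ℝ) : Prop :=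
  (∀ μ, MemM μ → FinSupp μ → IsAtomicSol β μ (Φ μ)) ∧
  (∀ μ, MemM μ → ∀ ε : ℝ, 0 < ε → ∃ δ : ℝ, 0 < δ ∧ ∀ ν, MemM ν → dM μ ν < δ →
      ∀ s ∈ Icc (0 : ℝ) 1, ∀ x : ℝ, |Φ μ s x - Φ ν s x| < ε)

/-- `B` is a standard Brownian motion under `P`. -/
def IsStdBM {Ω : Type*} [MeasurableSpace Ω] (P : Measure Ω) (B : ℝ → Ω → ℝ) : Prop :=
  (∀ t : ℝ, Measurable (B t)) ∧
  (∀ᵐ ω ∂P, B 0 ω = 0) ∧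
  (∀ᵐ ω ∂P, Continuous fun t => B t ω) ∧
  (∀ s t : ℝ, 0 ≤ s → s ≤ t →
    Measure.map (fun ω => B t ω - B s ω) P = gaussianReal 0 (Real.toNNReal (t - s))) ∧
  (∀ s t : ℝ, 0 ≤ s → s ≤ t →
    Indep (MeasurableSpace.comap (fun ω => B t ω - B s ω) inferInstance)
      (⨆ v ∈ Icc (0 : ℝ) s, MeasurableSpace.comap (B v) inferInstance) P)

/-- the space `𝓓[s,t]`: progressively measurable processes bounded by `1` on `[s,t]` -/
def InD {Ω : Type*} {mΩ : MeasurableSpace Ω} (𝓕 : Filtration ℝ mΩ) (s t : ℝ)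
    (u : ℝ → Ω → ℝ) : Prop :=
  ProgMeasurable 𝓕 u ∧ ∀ r ∈ Icc s t, ∀ ω, |u r ω| ≤ 1

/-- the norm `‖u‖ = (E ∫_s^t u(r)² dr)^{1/2}` on `𝓓[s,t]` -/
def normD {Ω : Type*} [MeasurableSpace Ω] (P : Measure Ω) (s t : ℝ)
    (u : ℝ → Ω → ℝ) : ℝ :=
  Real.sqrt (∫ ω, (∫ r in s..t, (u r ω) ^ 2) ∂P)

/-- the functional
`F^{s,t}(u,x) = E[Φ_μ(t, x + ∫_s^t α ζ u dr + W(t) - W(s)) - (1/2)∫_s^t α ζ u² dr]`,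
where `W r = B (ξ' r)`. -/
def Ffn {Ω : Type*} [MeasurableSpace Ω] (P : Measure Ω) (β : ℕ → ℝ) (μ : Measure ℝ)
    (Φ : ℝ → ℝ → ℝ) (W : ℝ → Ω → ℝ) (s t : ℝ) (u : ℝ → Ω → ℝ) (x : ℝ) : ℝ :=
  ∫ ω, (Φ t (x + (∫ r in s..t, distF μ r * zetaFn β r * u r ω) + (W t ω - W s ω))
      - (1 / 2) * ∫ r in s..t, distF μ r * zetaFn β r * (u r ω) ^ 2) ∂P


/-- `f ∈ C^{1,2}([0,1] × ℝ)`: `f` has a (jointly) continuous partial derivative in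
the time variable on `[0,1]` and a (jointly) continuous second partial derivative
in the space variable. -/
def MemC12 (f : ℝ → ℝ → ℝ) : Prop :=
  ∃ g : ℝ → ℝ → ℝ,
    (∀ x : ℝ, ∀ s ∈ Icc (0 : ℝ) 1,
      HasDerivWithinAt (fun r => f r x) (g s x) (Icc (0 : ℝ) 1) s) ∧
    ContinuousOn (fun p : ℝ × ℝ => g p.1 p.2) (Icc (0 : ℝ) 1 ×ˢ (univ : Set ℝ)) ∧
    (∀ s ∈ Icc (0 : ℝ) 1, ContDiff ℝ 2 (f s)) ∧
    ContinuousOn (fun p : ℝ × ℝ => iteratedDeriv 2 (f p.1) p.2)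
      (Icc (0 : ℝ) 1 ×ˢ (univ : Set ℝ))

/-! ### Gaussian integrals -/

lemma int_exp_abs (c : ℝ) :
    Integrable (fun z : ℝ => Real.exp (c * |z|)) (gaussianReal 0 1) := by
  have := integrable_exp_mul_abs (X := fun z : ℝ => z) (μ := gaussianReal 0 1) (t := c)
    (integrable_exp_mul_gaussianReal c) (integrable_exp_mul_gaussianReal (-c))
  exact this

lemma gauss_integrable {g : ℝ → ℝ} (hm : Measurable g) {C : ℝ}
    (h0 : ∀ y, |g y| ≤ C * Real.exp |y|) (σ x : ℝ) :
    Integrable (fun z => g (x + z * σ)) (gaussianReal 0 1) := by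
  have hC : 0 ≤ C := by
    have := (abs_nonneg _).trans (h0 0)
    simpa using this
  refine Integrable.mono' ((int_exp_abs |σ|).const_mul (C * Real.exp |x|)) ?_ ?_
  · exact (hm.comp (by fun_prop)).aestronglyMeasurable
  · refine Eventually.of_forall fun z => ?_
    rw [Real.norm_eq_abs]
    refine (h0 _).trans ?_
    rw [mul_assoc, ← Real.exp_add]
    gcongr
    calc |x + z * σ| ≤ |x| + |z * σ| := abs_add_le _ _
      _ = |x| + |σ| * |z| := by rw [abs_mul]; ring

lemma gauss_deriv {g g' : ℝ → ℝ} (hg : ∀ y, HasDerivAt g (g' y) y) {C : ℝ}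
    (h0 : ∀ y, |g y| ≤ C * Real.exp |y|) (h1 : ∀ y, |g' y| ≤ C * Real.exp |y|) (σ x : ℝ) :
    HasDerivAt (fun x => ∫ z, g (x + z * σ) ∂(gaussianReal 0 1))
      (∫ z, g' (x + z * σ) ∂(gaussianReal 0 1)) x := by
  have hC : 0 ≤ C := by
    have := (abs_nonneg _).trans (h0 0)
    simpa using this
  have hgc : Continuous g := continuous_iff_continuousAt.2 fun y => (hg y).continuousAt
  have hg'm : Measurable g' := by
    have : g' = deriv g := funext fun y => (hg y).deriv.symm
    rw [this]; exact measurable_deriv g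
  refine (hasDerivAt_integral_of_dominated_loc_of_deriv_le (μ := gaussianReal 0 1)
    (F := fun x z => g (x + z * σ)) (F' := fun x z => g' (x + z * σ)) (x₀ := x)
    (bound := fun z => (C * Real.exp (|x| + 1)) * Real.exp (|σ| * |z|))
    (Metric.ball_mem_nhds x one_pos) ?_ ?_ ?_ ?_ ?_ ?_).2
  · exact Eventually.of_forall fun y => (gauss_integrable hgc.measurable h0 σ y).1
  · exact gauss_integrable hgc.measurable h0 σ x
  · exact (gauss_integrable hg'm h1 σ x).1
  · refine Eventually.of_forall fun z y hy => ?_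
    rw [Real.norm_eq_abs]
    refine (h1 _).trans ?_
    rw [mul_assoc, ← Real.exp_add]
    gcongr
    have hy' : |y - x| < 1 := by simpa [Real.dist_eq] using hy
    have h2 : |y| ≤ |x| + 1 := by
      have := abs_add_le x (y - x)
      rw [add_sub_cancel] at this
      linarith
    calc |y + z * σ| ≤ |y| + |z * σ| := abs_add_le _ _
      _ = |y| + |σ| * |z| := by rw [abs_mul]; ring
      _ ≤ _ := by linarith
  · exact (int_exp_abs _).const_mul _
  · refine Eventually.of_forall fun z y _ => ?_
    exact (hg (y + z * σ)).comp_add_const y (z * σ)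

lemma mv_bound {r r' : ℝ → ℝ} (hr : ∀ y, HasDerivAt r (r' y) y) {x ρ B : ℝ} (hx : r x = 0)
    (hB : ∀ y, |y - x| ≤ ρ → |r' y| ≤ B) (y : ℝ) (hy : |y - x| ≤ ρ) : |r y| ≤ B * ρ := by
  have hρ : 0 ≤ ρ := (abs_nonneg _).trans hy
  have hB0 : 0 ≤ B := (abs_nonneg _).trans (hB y hy)
  have := (convex_closedBall x ρ).norm_image_sub_le_of_norm_hasDerivWithin_le
    (f := r) (f' := r') (C := B) (x := x) (y := y)
    (fun w _ => (hr w).hasDerivWithinAt)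
    (fun w hw => by
      rw [Real.norm_eq_abs]; exact hB w (by simpa [Real.dist_eq] using hw))
    (by simpa using hρ) (by simpa [Real.dist_eq] using hy)
  rw [hx, sub_zero, Real.norm_eq_abs, Real.norm_eq_abs] at this
  exact this.trans (by gcongr)

lemma taylor3 {g g1 g2 g3 : ℝ → ℝ} (h0 : ∀ y, HasDerivAt g (g1 y) y)
    (h1 : ∀ y, HasDerivAt g1 (g2 y) y) (h2 : ∀ y, HasDerivAt g2 (g3 y) y) (x h B : ℝ)
    (hB : ∀ y, |y - x| ≤ |h| → |g3 y| ≤ B) :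
    |g (x + h) - g x - h * g1 x - h ^ 2 / 2 * g2 x| ≤ B * |h| ^ 3 := by
  have e2 := mv_bound (r := fun y => g2 y - g2 x) (r' := g3) (x := x) (ρ := |h|) (B := B)
    (fun y => (h2 y).sub_const _) (by simp) hB
  have e1 := mv_bound (r := fun y => g1 y - g1 x - (y - x) * g2 x)
    (r' := fun y => g2 y - g2 x) (x := x) (ρ := |h|) (B := B * |h|)
    (fun y => by
      have := ((h1 y).sub_const (g1 x)).sub (((hasDerivAt_id y).sub_const x).mul_const (g2 x))
      refine this.congr_deriv ?_
      simp) (by simp) e2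
  have e0 := mv_bound (r := fun y => g y - g x - (y - x) * g1 x - (y - x) ^ 2 / 2 * g2 x)
    (r' := fun y => g1 y - g1 x - (y - x) * g2 x) (x := x) (ρ := |h|) (B := B * |h| * |h|)
    (fun y => by
      have := (((h0 y).sub_const (g x)).sub
        (((hasDerivAt_id y).sub_const x).mul_const (g1 x))).sub
        (((((hasDerivAt_id y).sub_const x).pow 2).div_const 2).mul_const (g2 x))
      refine this.congr_deriv ?_
      simp) (by simp) e1 (x + h) (by simp)
  have e : x + h - x = h := by ring
  simp only [e] at e0
  linarith [e0, show B * |h| * |h| * |h| = B * |h| ^ 3 by ring]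

/-- the constant `E |z|³ e^{|z|}` -/
def c3 : ℝ := ∫ z, |z| ^ 3 * Real.exp |z| ∂(gaussianReal 0 1)

lemma c3_int : Integrable (fun z : ℝ => |z| ^ 3 * Real.exp |z|) (gaussianReal 0 1) := by
  refine Integrable.mono' ((int_exp_abs 2).const_mul 6) ?_ ?_
  · exact (by fun_prop : Continuous fun z : ℝ => |z| ^ 3 * Real.exp |z|).aestronglyMeasurable
  · refine Eventually.of_forall fun z => ?_
    rw [Real.norm_eq_abs, abs_of_nonneg (by positivity)]
    have h : |z| ^ 3 / (Nat.factorial 3 : ℝ) ≤ Real.exp |z| :=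
      Real.pow_div_factorial_le_exp _ (abs_nonneg z) 3
    have h6 : (Nat.factorial 3 : ℝ) = 6 := by norm_num [Nat.factorial]
    rw [h6] at h
    have h' : |z| ^ 3 ≤ 6 * Real.exp |z| := by linarith
    calc |z| ^ 3 * Real.exp |z| ≤ 6 * Real.exp |z| * Real.exp |z| := by gcongr
      _ = 6 * Real.exp (2 * |z|) := by rw [two_mul, Real.exp_add]; ring

lemma c3_nonneg : 0 ≤ c3 := integral_nonneg fun z => by positivity

lemma gauss_sq : ∫ z, z ^ 2 ∂(gaussianReal 0 1) = 1 := by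
  have h := variance_id_gaussianReal (μ := 0) (v := 1)
  rw [variance_of_integral_eq_zero (by fun_prop) (by simp)] at h
  simpa using h

lemma gauss_sq_int : Integrable (fun z : ℝ => z ^ 2) (gaussianReal 0 1) := by
  have := (memLp_id_gaussianReal (μ := 0) (v := 1) 2).integrable_sq
  simpa using this

lemma gauss_id_int : Integrable (fun z : ℝ => z) (gaussianReal 0 1) := by
  have := (memLp_id_gaussianReal (μ := 0) (v := 1) 1).integrable (by simp)
  exact this

lemma gauss_taylor {g g1 g2 g3 : ℝ → ℝ} (h0 : ∀ y, HasDerivAt g (g1 y) y)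
    (h1 : ∀ y, HasDerivAt g1 (g2 y) y) (h2 : ∀ y, HasDerivAt g2 (g3 y) y) (x σ B : ℝ)
    (hσ0 : 0 ≤ σ) (hσ : σ ≤ 1)
    (hB : ∀ y, |g3 y| ≤ B * Real.exp |y - x|)
    (hint : Integrable (fun z => g (x + z * σ)) (gaussianReal 0 1)) :
    |(∫ z, g (x + z * σ) ∂(gaussianReal 0 1)) - g x - σ ^ 2 / 2 * g2 x| ≤ B * c3 * σ ^ 3 := by
  have hB0 : 0 ≤ B := by
    have := (abs_nonneg _).trans (hB x)
    simpa using this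
  have key : (∫ z, g (x + z * σ) ∂(gaussianReal 0 1)) - g x - σ ^ 2 / 2 * g2 x
      = ∫ z, (g (x + z * σ) - g x - (z * σ) * g1 x - (z * σ) ^ 2 / 2 * g2 x)
        ∂(gaussianReal 0 1) := by
    have i1 : Integrable (fun z : ℝ => (z * σ) * g1 x) (gaussianReal 0 1) :=
      (gauss_id_int.mul_const σ).mul_const _
    have i2 : Integrable (fun z : ℝ => (z * σ) ^ 2 / 2 * g2 x) (gaussianReal 0 1) := by
      have := gauss_sq_int.mul_const (σ ^ 2 / 2 * g2 x)
      refine this.congr (Eventually.of_forall fun z => ?_)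
      simp only; ring
    have i0 : Integrable (fun _ : ℝ => g x) (gaussianReal 0 1) := integrable_const _
    have j1 : Integrable (fun z => g (x + z * σ) - g x) (gaussianReal 0 1) := hint.sub i0
    have j2 : Integrable (fun z => g (x + z * σ) - g x - (z * σ) * g1 x) (gaussianReal 0 1) :=
      j1.sub i1
    rw [integral_sub j2 i2, integral_sub j1 i1, integral_sub hint i0]
    have e1 : ∫ z : ℝ, (z * σ) * g1 x ∂(gaussianReal 0 1) = 0 := by
      simp_rw [mul_assoc]
      rw [integral_mul_const, integral_id_gaussianReal, zero_mul]
    have e2 : ∫ z : ℝ, (z * σ) ^ 2 / 2 * g2 x ∂(gaussianReal 0 1) = σ ^ 2 / 2 * g2 x := by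
      have : (fun z : ℝ => (z * σ) ^ 2 / 2 * g2 x) = fun z => z ^ 2 * (σ ^ 2 / 2 * g2 x) := by
        funext z; ring
      rw [this, integral_mul_const, gauss_sq, one_mul]
    rw [e1, e2]; simp
  rw [key, ← Real.norm_eq_abs]
  have : B * c3 * σ ^ 3 = ∫ z, (B * σ ^ 3) * (|z| ^ 3 * Real.exp |z|) ∂(gaussianReal 0 1) := by
    rw [integral_const_mul, c3]; ring
  rw [this]
  refine norm_integral_le_of_norm_le (c3_int.const_mul _) (Eventually.of_forall fun z => ?_)
  rw [Real.norm_eq_abs]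
  have hz : |z * σ| ≤ |z| := by
    rw [abs_mul, abs_of_nonneg hσ0]
    exact mul_le_of_le_one_right (abs_nonneg _) hσ
  refine (taylor3 h0 h1 h2 x (z * σ) (B * Real.exp |z|) fun y hy => (hB y).trans ?_).trans ?_
  · exact mul_le_mul_of_nonneg_left (Real.exp_le_exp.2 (hy.trans hz)) hB0
  · rw [abs_mul, abs_of_nonneg hσ0]
    apply le_of_eq; ring

/-! ### Jets and one step of the recursion -/

/-- `a 0, …, a 5` are successive derivatives -/
def IsJet (a : ℕ → ℝ → ℝ) : Prop := ∀ i, i < 5 → ∀ x, HasDerivAt (a i) (a (i + 1) x) x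

/-- `e^{-m f} ∂^j e^{m f} / m` in terms of the derivatives of `f` (for `1 ≤ j ≤ 5`) -/
def HH (a : ℕ → ℝ → ℝ) (m : ℝ) : ℕ → ℝ → ℝ
  | 2 => fun x => a 2 x + m * a 1 x ^ 2
  | 3 => fun x => a 3 x + 3 * m * (a 1 x * a 2 x) + m ^ 2 * a 1 x ^ 3
  | 4 => fun x => a 4 x + 3 * m * a 2 x ^ 2 + 4 * m * (a 1 x * a 3 x)
      + 6 * m ^ 2 * (a 1 x ^ 2 * a 2 x) + m ^ 3 * a 1 x ^ 4
  | 5 => fun x => a 5 x + 5 * m * (a 1 x * a 4 x) + 10 * m * (a 2 x * a 3 x)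
      + 10 * m ^ 2 * (a 1 x ^ 2 * a 3 x) + 15 * m ^ 2 * (a 1 x * a 2 x ^ 2)
      + 10 * m ^ 3 * (a 1 x ^ 3 * a 2 x) + m ^ 4 * a 1 x ^ 5
  | j => a j

lemma HH_deriv {a : ℕ → ℝ → ℝ} (ha : IsJet a) (m : ℝ) (j : ℕ) (h1 : 1 ≤ j) (h4 : j ≤ 4) (x : ℝ) :
    HasDerivAt (HH a m j) (HH a m (j + 1) x - m * a 1 x * HH a m j x) x := by
  have d1 := ha 1 (by norm_num) x
  have d2 := ha 2 (by norm_num) x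
  have d3 := ha 3 (by norm_num) x
  have d4 := ha 4 (by norm_num) x
  norm_num at d1 d2 d3 d4
  interval_cases j
  · simp only [HH]
    refine d1.congr_deriv ?_
    ring
  · simp only [HH]
    refine (d2.add ((d1.pow 2).const_mul m)).congr_deriv ?_
    norm_num; ring
  · simp only [HH]
    refine ((d3.add ((d1.mul d2).const_mul (3 * m))).add
      ((d1.pow 3).const_mul (m ^ 2))).congr_deriv ?_
    norm_num; ring
  · simp only [HH]
    refine ((((d4.add ((d2.pow 2).const_mul (3 * m))).add ((d1.mul d3).const_mul (4 * m))).add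
      (((d1.pow 2).mul d2).const_mul (6 * m ^ 2))).add
      ((d1.pow 4).const_mul (m ^ 3))).congr_deriv ?_
    norm_num; ring

lemma chain_of_T {T : ℕ → ℝ → ℝ} {m : ℝ}
    (hT : ∀ j, 1 ≤ j → j ≤ 4 → ∀ x, HasDerivAt (T j) (T (j + 1) x - m * T 1 x * T j x) x)
    {Ψ : ℝ → ℝ} (hΨ : ∀ x, HasDerivAt Ψ (T 1 x) x) :
    ∃ b : ℕ → ℝ → ℝ, IsJet b ∧ b 0 = Ψ ∧ ∀ j, 1 ≤ j → j ≤ 5 → ∀ x, HH b m j x = T j x := by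
  let b2 : ℝ → ℝ := fun x => T 2 x - m * T 1 x ^ 2
  let b3 : ℝ → ℝ := fun x => T 3 x - 3 * m * (T 1 x * b2 x) - m ^ 2 * T 1 x ^ 3
  let b4 : ℝ → ℝ := fun x => T 4 x - 3 * m * b2 x ^ 2 - 4 * m * (T 1 x * b3 x)
      - 6 * m ^ 2 * (T 1 x ^ 2 * b2 x) - m ^ 3 * T 1 x ^ 4
  let b5 : ℝ → ℝ := fun x => T 5 x - 5 * m * (T 1 x * b4 x) - 10 * m * (b2 x * b3 x)
      - 10 * m ^ 2 * (T 1 x ^ 2 * b3 x) - 15 * m ^ 2 * (T 1 x * b2 x ^ 2)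
      - 10 * m ^ 3 * (T 1 x ^ 3 * b2 x) - m ^ 4 * T 1 x ^ 5
  have d1 : ∀ x, HasDerivAt (T 1) (b2 x) x := fun x => by
    refine (hT 1 le_rfl (by norm_num) x).congr_deriv ?_
    simp only [b2]; ring
  have d2 : ∀ x, HasDerivAt b2 (b3 x) x := fun x => by
    refine ((hT 2 (by norm_num) (by norm_num) x).sub
      (((d1 x).pow 2).const_mul m)).congr_deriv ?_
    simp only [b3, b2]; norm_num; ring
  have d3 : ∀ x, HasDerivAt b3 (b4 x) x := fun x => by
    refine (((hT 3 (by norm_num) (by norm_num) x).sub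
      (((d1 x).mul (d2 x)).const_mul (3 * m))).sub
      (((d1 x).pow 3).const_mul (m ^ 2))).congr_deriv ?_
    simp only [b4, b3, b2]; norm_num; ring
  have d4 : ∀ x, HasDerivAt b4 (b5 x) x := fun x => by
    refine (((((hT 4 (by norm_num) (by norm_num) x).sub
      (((d2 x).pow 2).const_mul (3 * m))).sub
      (((d1 x).mul (d3 x)).const_mul (4 * m))).sub
      ((((d1 x).pow 2).mul (d2 x)).const_mul (6 * m ^ 2))).sub
      (((d1 x).pow 4).const_mul (m ^ 3))).congr_deriv ?_
    simp only [b5, b4, b3, b2]; norm_num; ring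
  refine ⟨fun i => match i with
    | 0 => Ψ | 1 => T 1 | 2 => b2 | 3 => b3 | 4 => b4 | _ => b5, ?_, rfl, ?_⟩
  · intro i hi x
    interval_cases i
    · exact hΨ x
    · exact d1 x
    · exact d2 x
    · exact d3 x
    · exact d4 x
  · intro j h1 h5 x
    interval_cases j
    · rfl
    · simp only [HH, b2]; ring
    · simp only [HH, b3]; ring
    · simp only [HH, b4]; ring
    · simp only [HH, b5]; ring

/-- the one-step map -/
def stepF (f : ℝ → ℝ) (m σ x : ℝ) : ℝ :=
  if m = 0 then ∫ z, f (x + z * σ) ∂(gaussianReal 0 1)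
  else m⁻¹ * Real.log (∫ z, Real.exp (m * f (x + z * σ)) ∂(gaussianReal 0 1))

lemma lip_of_deriv {f f' : ℝ → ℝ} (hf : ∀ x, HasDerivAt f (f' x) x) {K : ℝ}
    (hK : ∀ x, |f' x| ≤ K) (x y : ℝ) : |f x - f y| ≤ K * |x - y| := by
  have := convex_univ.norm_image_sub_le_of_norm_hasDerivWithin_le (f := f) (f' := f') (C := K)
    (x := y) (y := x) (fun w _ => (hf w).hasDerivWithinAt)
    (fun w _ => by rw [Real.norm_eq_abs]; exact hK w) (mem_univ _) (mem_univ _)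
  simpa [Real.norm_eq_abs] using this

lemma exp_growth {f : ℝ → ℝ} {m : ℝ} (hm0 : 0 ≤ m) (hm1 : m ≤ 1)
    (hL : ∀ x y, |f x - f y| ≤ 1 * |x - y|) (y : ℝ) :
    Real.exp (m * f y) ≤ Real.exp |f 0| * Real.exp |y| := by
  rw [← Real.exp_add, Real.exp_le_exp]
  have h1 := hL y 0
  have h2 : f y ≤ |f 0| + |y| := by
    have := le_abs_self (f y - f 0)
    have := le_abs_self (f 0)
    rw [sub_zero, one_mul] at h1
    linarith
  have h3 : 0 ≤ |f 0| + |y| := by positivity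
  calc m * f y ≤ m * (|f 0| + |y|) := by gcongr
    _ ≤ _ := mul_le_of_le_one_left h3 hm1

lemma le_exp_abs (y : ℝ) : |y| ≤ Real.exp |y| := by
  linarith [Real.add_one_le_exp |y|]

lemma lin_growth {f : ℝ → ℝ} (hL : ∀ x y, |f x - f y| ≤ 1 * |x - y|) (y : ℝ) :
    |f y| ≤ (|f 0| + 1) * Real.exp |y| := by
  have h1 := hL y 0
  rw [sub_zero, one_mul] at h1
  have h2 : |f y| ≤ |f 0| + |y| := by
    have := abs_add_le (f 0) (f y - f 0)
    rw [add_sub_cancel] at this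
    linarith
  have h3 := le_exp_abs y
  have h4 : 1 ≤ Real.exp |y| := Real.one_le_exp (abs_nonneg _)
  nlinarith [abs_nonneg (f 0)]

lemma step_jet {a : ℕ → ℝ → ℝ} (ha : IsJet a) {m : ℝ} (hm0 : 0 ≤ m) (hm1 : m ≤ 1) (σ M : ℝ)
    (ha1 : ∀ x, |a 1 x| ≤ 1) (hM : ∀ j, 1 ≤ j → j ≤ 5 → ∀ x, |HH a m j x| ≤ M) :
    ∃ b : ℕ → ℝ → ℝ, IsJet b ∧ b 0 = stepF (a 0) m σ ∧
      ∀ j, 1 ≤ j → j ≤ 5 → ∀ N, (∀ y, |HH a m j y| ≤ N) → ∀ x, |HH b m j x| ≤ N := by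
  have hM0 : 0 ≤ M := (abs_nonneg _).trans (hM 1 le_rfl (by norm_num) 0)
  have hL := lip_of_deriv (fun x => ha 0 (by norm_num) x) ha1
  have hcont : Continuous (a 0) :=
    continuous_iff_continuousAt.2 fun y => (ha 0 (by norm_num) y).continuousAt
  set E : ℝ := Real.exp |a 0 0| with hE
  have hE1 : 1 ≤ E := Real.one_le_exp (abs_nonneg _)
  let u0 : ℝ → ℝ := fun x => ∫ z, Real.exp (m * a 0 (x + z * σ)) ∂(gaussianReal 0 1)
  let u : ℕ → ℝ → ℝ := fun j x =>
    ∫ z, (Real.exp (m * a 0 (x + z * σ)) * HH a m j (x + z * σ)) ∂(gaussianReal 0 1)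
  have g0 : ∀ y, Real.exp (m * a 0 y) ≤ E * Real.exp |y| := exp_growth hm0 hm1 hL
  have gj : ∀ j, 1 ≤ j → j ≤ 5 → ∀ y,
      |Real.exp (m * a 0 y) * HH a m j y| ≤ (E * (M + 1)) * Real.exp |y| := by
    intro j h1 h5 y
    rw [abs_mul, abs_of_pos (Real.exp_pos _)]
    have e1 := g0 y
    have e2 := hM j h1 h5 y
    calc Real.exp (m * a 0 y) * |HH a m j y| ≤ (E * Real.exp |y|) * (M + 1) := by
          gcongr; linarith
      _ = _ := by ring
  have hexpd : ∀ y, HasDerivAt (fun y => Real.exp (m * a 0 y))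
      (m * (Real.exp (m * a 0 y) * HH a m 1 y)) y := fun y => by
    refine ((ha 0 (by norm_num) y).const_mul m).exp.congr_deriv ?_
    simp only [HH]; ring
  have du0 : ∀ x, HasDerivAt u0 (m * u 1 x) x := fun x => by
    have := gauss_deriv (g := fun y => Real.exp (m * a 0 y)) hexpd (C := E * (M + 1))
      (fun y => by
        rw [abs_of_pos (Real.exp_pos _)]
        refine (g0 y).trans ?_
        have : E ≤ E * (M + 1) := le_mul_of_one_le_right (by linarith) (by linarith)
        gcongr)
      (fun y => by
        rw [abs_mul, abs_of_nonneg hm0]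
        exact (mul_le_of_le_one_left (abs_nonneg _) hm1).trans (gj 1 le_rfl (by norm_num) y))
      σ x
    refine this.congr_deriv ?_
    simp only [u]
    rw [integral_const_mul]
  have du : ∀ j, 1 ≤ j → j ≤ 4 → ∀ x, HasDerivAt (u j) (u (j + 1) x) x := fun j h1 h4 x => by
    refine gauss_deriv (g := fun y => Real.exp (m * a 0 y) * HH a m j y)
      (g' := fun y => Real.exp (m * a 0 y) * HH a m (j + 1) y) ?_ (C := E * (M + 1))
      (gj j h1 (by omega)) (gj (j + 1) (by omega) (by omega)) σ x
    intro y
    refine ((hexpd y).mul (HH_deriv ha m j h1 h4 y)).congr_deriv ?_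
    simp only [HH]; ring
  have i0 : ∀ x, Integrable (fun z => Real.exp (m * a 0 (x + z * σ))) (gaussianReal 0 1) :=
    fun x => gauss_integrable (g := fun y => Real.exp (m * a 0 y)) (by fun_prop)
      (fun y => by rw [abs_of_pos (Real.exp_pos _)]; exact g0 y) σ x
  have u0pos : ∀ x, 0 < u0 x := fun x => integral_exp_pos (i0 x)
  let T : ℕ → ℝ → ℝ := fun j x => u j x / u0 x
  have hT : ∀ j, 1 ≤ j → j ≤ 4 → ∀ x,
      HasDerivAt (T j) (T (j + 1) x - m * T 1 x * T j x) x := fun j h1 h4 x => by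
    refine ((du j h1 h4 x).div (du0 x) (u0pos x).ne').congr_deriv ?_
    simp only [T]
    have := (u0pos x).ne'
    field_simp
  have hΨ : ∀ x, HasDerivAt (stepF (a 0) m σ) (T 1 x) x := fun x => by
    by_cases hm : m = 0
    · have e : stepF (a 0) m σ = fun x => ∫ z, a 0 (x + z * σ) ∂(gaussianReal 0 1) := by
        funext y; simp [stepF, hm]
      rw [e]
      have := gauss_deriv (g := a 0) (g' := a 1) (fun y => ha 0 (by norm_num) y)
        (C := |a 0 0| + 1) (lin_growth hL) (fun y => (ha1 y).trans (by
          have : 1 ≤ Real.exp |y| := Real.one_le_exp (abs_nonneg _)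
          nlinarith [abs_nonneg (a 0 0)])) σ x
      refine this.congr_deriv ?_
      simp [T, u, u0, hm, HH]
    · have e : stepF (a 0) m σ = fun x => m⁻¹ * Real.log (u0 x) := by
        funext y; simp [stepF, hm, u0]
      rw [e]
      refine (((du0 x).log (u0pos x).ne').const_mul m⁻¹).congr_deriv ?_
      simp only [T]
      field_simp
  obtain ⟨b, hb, hb0, hbT⟩ := chain_of_T hT hΨ
  refine ⟨b, hb, hb0, fun j h1 h5 N hN x => ?_⟩
  rw [hbT j h1 h5 x]
  simp only [T]
  rw [abs_div, abs_of_pos (u0pos x), div_le_iff₀ (u0pos x)]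
  simp only [u, u0]
  rw [← integral_const_mul, ← Real.norm_eq_abs]
  refine norm_integral_le_of_norm_le ((i0 x).const_mul N) (Eventually.of_forall fun z => ?_)
  rw [Real.norm_eq_abs, abs_mul, abs_of_pos (Real.exp_pos _), mul_comm]
  gcongr
  exact hN _

/-- second order expansion of one step -/
lemma step_expand (K : ℝ) (hK : 1 ≤ K) (ε : ℝ) (hε : 0 < ε) :
    ∃ δ > 0, ∀ (a : ℕ → ℝ → ℝ) (m σ : ℝ), IsJet a → (∀ x, |a 1 x| ≤ 1) → (∀ x, |a 2 x| ≤ K) →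
      (∀ x, |a 3 x| ≤ K) → 0 ≤ m → m ≤ 1 → 0 ≤ σ → σ ≤ δ → ∀ x,
      |stepF (a 0) m σ x - a 0 x - σ ^ 2 / 2 * (a 2 x + m * a 1 x ^ 2)| ≤ ε * σ ^ 2 := by
  set c := 5 * K * c3 with hc
  have hc0 : 0 ≤ c := by have := c3_nonneg; positivity
  set D := K + 1 + c with hD
  have hD1 : 1 ≤ D := by linarith
  refine ⟨min 1 (min (1 / (2 * D)) (ε / (2 * D ^ 2 + c))), ?_, ?_⟩
  · have : 0 < 2 * D ^ 2 + c := by positivity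
    positivity
  intro a m σ ha h1 h2 h3 hm0 hm1 hσ0 hσ x
  have hσ1 : σ ≤ 1 := hσ.trans (min_le_left _ _)
  have hσ2 : σ ≤ 1 / (2 * D) := hσ.trans ((min_le_right _ _).trans (min_le_left _ _))
  have hσ3 : σ ≤ ε / (2 * D ^ 2 + c) := hσ.trans ((min_le_right _ _).trans (min_le_right _ _))
  rw [le_div_iff₀ (by positivity)] at hσ2 hσ3
  have hL := lip_of_deriv (fun x => ha 0 (by norm_num) x) h1
  have hcont : Continuous (a 0) :=
    continuous_iff_continuousAt.2 fun y => (ha 0 (by norm_num) y).continuousAt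
  have d0 := ha 0 (by norm_num)
  have d1 := ha 1 (by norm_num)
  have d2 := ha 2 (by norm_num)
  norm_num at d0 d1 d2
  have hsq : 0 ≤ σ ^ 2 := sq_nonneg σ
  have hsq1 : σ ^ 2 ≤ σ := by nlinarith
  by_cases hm : m = 0
  · have e : stepF (a 0) m σ x = ∫ z, a 0 (x + z * σ) ∂(gaussianReal 0 1) := by
      simp [stepF, hm]
    rw [e, hm, zero_mul, add_zero]
    have := gauss_taylor d0 d1 d2 x σ K hσ0 hσ1
      (fun y => (h3 y).trans (le_mul_of_one_le_right (by linarith)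
        (Real.one_le_exp (abs_nonneg _))))
      (gauss_integrable hcont.measurable (lin_growth hL) σ x)
    refine this.trans ?_
    have h5 : K * c3 ≤ c := by have := mul_nonneg (by linarith : 0 ≤ K) c3_nonneg; linarith
    calc K * c3 * σ ^ 3 ≤ c * σ ^ 3 := by gcongr
      _ = (σ * c) * σ ^ 2 := by ring
      _ ≤ ε * σ ^ 2 := by gcongr; nlinarith [sq_nonneg D]
  · have hmpos : 0 < m := lt_of_le_of_ne hm0 (Ne.symm hm)
    let g : ℝ → ℝ := fun y => Real.exp (m * (a 0 y - a 0 x))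
    have dg : ∀ y, HasDerivAt g (m * a 1 y * g y) y := fun y => by
      refine (((d0 y).sub_const (a 0 x)).const_mul m).exp.congr_deriv ?_
      simp only [g]; ring
    let g2 : ℝ → ℝ := fun y => m * (a 2 y + m * a 1 y ^ 2) * g y
    let g3 : ℝ → ℝ := fun y =>
      m * (a 3 y + 3 * m * (a 1 y * a 2 y) + m ^ 2 * a 1 y ^ 3) * g y
    have dg1 : ∀ y, HasDerivAt (fun y => m * a 1 y * g y) (g2 y) y := fun y => by
      refine (((d1 y).const_mul m).mul (dg y)).congr_deriv ?_
      simp only [g2]; ring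
    have dg2 : ∀ y, HasDerivAt g2 (g3 y) y := fun y => by
      refine ((((d2 y).add (((d1 y).pow 2).const_mul m)).const_mul m).mul (dg y)).congr_deriv ?_
      simp only [g3]; norm_num; ring
    have hg3 : ∀ y, |g3 y| ≤ (m * (5 * K)) * Real.exp |y - x| := fun y => by
      simp only [g3]
      rw [abs_mul, abs_mul, abs_of_pos hmpos]
      have b1 : |a 3 y + 3 * m * (a 1 y * a 2 y) + m ^ 2 * a 1 y ^ 3| ≤ 5 * K := by
        have t1 := abs_add_three (a 3 y) (3 * m * (a 1 y * a 2 y)) (m ^ 2 * a 1 y ^ 3)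
        have t2 : |3 * m * (a 1 y * a 2 y)| ≤ 3 * K := by
          rw [abs_mul, abs_mul, abs_mul, abs_of_pos hmpos]
          have : |(3:ℝ)| = 3 := by norm_num
          rw [this]
          have : m * (|a 1 y| * |a 2 y|) ≤ 1 * (1 * K) := by
            gcongr
            · exact h1 y
            · exact h2 y
          linarith
        have t3 : |m ^ 2 * a 1 y ^ 3| ≤ 1 := by
          rw [abs_mul, abs_pow, abs_pow, abs_of_pos hmpos]
          exact mul_le_one₀ (pow_le_one₀ hm0 hm1) (by positivity)
            (pow_le_one₀ (abs_nonneg _) (h1 y))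
        have := h3 y
        linarith
      have b2 : |g y| ≤ Real.exp |y - x| := by
        rw [abs_of_pos (Real.exp_pos _)]
        apply Real.exp_le_exp.2
        have := hL y x
        have q := le_abs_self (a 0 y - a 0 x)
        calc m * (a 0 y - a 0 x) ≤ m * |y - x| := by
              gcongr; linarith
          _ ≤ _ := mul_le_of_le_one_left (abs_nonneg _) hm1
      gcongr
    have ig : Integrable (fun z => Real.exp (m * a 0 (x + z * σ))) (gaussianReal 0 1) :=
      gauss_integrable (g := fun y => Real.exp (m * a 0 y)) (by fun_prop)
        (fun y => by rw [abs_of_pos (Real.exp_pos _)]; exact exp_growth hm0 hm1 hL y) σ x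
    have eg : ∀ y, g y = Real.exp (m * a 0 y) * Real.exp (-(m * a 0 x)) := fun y => by
      rw [← Real.exp_add]; simp only [g]; ring_nf
    have ig' : Integrable (fun z => g (x + z * σ)) (gaussianReal 0 1) := by
      simp_rw [eg]; exact ig.mul_const _
    have key := gauss_taylor dg dg1 dg2 x σ (m * (5 * K)) hσ0 hσ1 hg3 ig'
    set A := ∫ z, g (x + z * σ) ∂(gaussianReal 0 1) with hA
    have hApos : 0 < A := integral_exp_pos ig'
    have hgx : g x = 1 := by simp [g]
    have hg2x : g2 x = m * (a 2 x + m * a 1 x ^ 2) := by simp [g2, hgx]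
    rw [hgx, hg2x] at key
    set F := a 2 x + m * a 1 x ^ 2 with hF
    have hFb : |F| ≤ K + 1 := by
      have t1 := abs_add_le (a 2 x) (m * a 1 x ^ 2)
      have t2 : |m * a 1 x ^ 2| ≤ 1 := by
        rw [abs_mul, abs_pow, abs_of_pos hmpos]
        exact mul_le_one₀ hm1 (by positivity) (pow_le_one₀ (abs_nonneg _) (h1 x))
      linarith [h2 x]
    have hstep : stepF (a 0) m σ x - a 0 x = m⁻¹ * Real.log A := by
      have e1 : A = (∫ z, Real.exp (m * a 0 (x + z * σ)) ∂(gaussianReal 0 1))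
          * Real.exp (-(m * a 0 x)) := by
        rw [hA, ← integral_mul_const]; simp_rw [eg]
      have p1 := (integral_exp_pos ig).ne'
      rw [e1, Real.log_mul p1 (Real.exp_pos _).ne', Real.log_exp]
      simp only [stepF, hm, if_false]
      have e3 : m⁻¹ * (-(m * a 0 x)) = -a 0 x := by field_simp
      rw [mul_add, e3]
      exact sub_eq_add_neg _ _
    rw [hstep]
    have key' : |A - 1 - σ ^ 2 / 2 * (m * F)| ≤ m * (c * σ ^ 3) := by
      refine key.trans (le_of_eq ?_); rw [hc]; ring
    have hA1 : |A - 1| ≤ m * (D * σ ^ 2) := by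
      have t := abs_add_le (A - 1 - σ ^ 2 / 2 * (m * F)) (σ ^ 2 / 2 * (m * F))
      rw [sub_add_cancel] at t
      have t2 : |σ ^ 2 / 2 * (m * F)| ≤ m * (σ ^ 2 * (K + 1)) := by
        rw [abs_mul, abs_mul, abs_of_pos hmpos, abs_of_nonneg (by positivity)]
        have : 0 ≤ m * (σ ^ 2 * |F|) := by positivity
        calc σ ^ 2 / 2 * (m * |F|) = (m * (σ ^ 2 * |F|)) / 2 := by ring
          _ ≤ m * (σ ^ 2 * |F|) := by linarith
          _ ≤ _ := by gcongr
      have t3 : m * (c * σ ^ 3) ≤ m * (c * σ ^ 2) := by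
        have : σ ^ 3 ≤ σ ^ 2 := pow_le_pow_of_le_one hσ0 hσ1 (by norm_num)
        gcongr
      calc |A - 1| ≤ m * (c * σ ^ 2) + m * (σ ^ 2 * (K + 1)) := by linarith
        _ = _ := by rw [hD]; ring
    have hDs : D * σ ^ 2 ≤ 1 / 2 := by nlinarith
    have hA2 : |A - 1| ≤ 1 / 2 := hA1.trans (by
      have : m * (D * σ ^ 2) ≤ D * σ ^ 2 := mul_le_of_le_one_left (by positivity) hm1
      linarith)
    have hlog : |Real.log A - (A - 1)| ≤ 2 * (A - 1) ^ 2 := by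
      have u1 := Real.log_le_sub_one_of_pos hApos
      have u2 := Real.one_sub_inv_le_log_of_pos hApos
      have hAl : 1 / 2 ≤ A := by have := (abs_le.1 hA2).1; linarith
      rw [abs_le]
      constructor
      · have : 1 - A⁻¹ - (A - 1) = -((A - 1) ^ 2 / A) := by field_simp; ring
        have h5 : (A - 1) ^ 2 / A ≤ 2 * (A - 1) ^ 2 := by
          rw [div_le_iff₀ hApos]; nlinarith [sq_nonneg (A - 1)]
        linarith
      · nlinarith [sq_nonneg (A - 1)]
    have hsqA : (A - 1) ^ 2 ≤ m * (m * (D * σ ^ 2) ^ 2) := by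
      rw [← sq_abs]
      calc |A - 1| ^ 2 ≤ (m * (D * σ ^ 2)) ^ 2 := by gcongr
        _ = _ := by ring
    have tot : |Real.log A - m * (σ ^ 2 / 2 * F)| ≤ m * (2 * (D * σ ^ 2) ^ 2 + c * σ ^ 3) := by
      have t := abs_add_le (Real.log A - (A - 1)) (A - 1 - σ ^ 2 / 2 * (m * F))
      have e : Real.log A - (A - 1) + (A - 1 - σ ^ 2 / 2 * (m * F))
          = Real.log A - m * (σ ^ 2 / 2 * F) := by ring
      rw [e] at t
      have : m * (m * (D * σ ^ 2) ^ 2) ≤ m * (1 * (D * σ ^ 2) ^ 2) := by gcongr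
      linarith
    have e2 : m⁻¹ * Real.log A - σ ^ 2 / 2 * F = m⁻¹ * (Real.log A - m * (σ ^ 2 / 2 * F)) := by
      field_simp
    rw [e2, abs_mul, abs_of_pos (inv_pos.2 hmpos), inv_mul_le_iff₀ hmpos]
    refine tot.trans ?_
    gcongr
    calc 2 * (D * σ ^ 2) ^ 2 + c * σ ^ 3 = (2 * D ^ 2 * σ ^ 2 + c * σ) * σ ^ 2 := by ring
      _ ≤ (2 * D ^ 2 * σ + c * σ) * σ ^ 2 := by gcongr
      _ = (σ * (2 * D ^ 2 + c)) * σ ^ 2 := by ring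
      _ ≤ ε * σ ^ 2 := by gcongr

/-! ### The function `ξ'` -/

lemma beta_bound {β : ℕ → ℝ} (hβ : ValidBeta β) :
    Summable fun p : ℕ => (p : ℝ) ^ 2 * β p ^ 2 * (3 / 2 : ℝ) ^ p := by
  obtain ⟨_, _, _, _, hs⟩ := hβ
  have h1 : Summable fun p : ℕ => (p : ℝ) ^ 2 * (3 / 4 : ℝ) ^ p :=
    summable_pow_mul_geometric_of_norm_lt_one 2 (by norm_num)
  obtain ⟨C, hC⟩ := h1.tendsto_atTop_zero.bddAbove_range
  refine Summable.of_nonneg_of_le (fun p => by positivity) (fun p => ?_) (hs.mul_left C)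
  have h2 : (p : ℝ) ^ 2 * (3 / 4 : ℝ) ^ p ≤ C := hC ⟨p, rfl⟩
  have h3 : (3 / 2 : ℝ) ^ p = (3 / 4) ^ p * 2 ^ p := by rw [← mul_pow]; norm_num
  calc (p : ℝ) ^ 2 * β p ^ 2 * (3 / 2 : ℝ) ^ p
      = ((p : ℝ) ^ 2 * (3 / 4 : ℝ) ^ p) * (2 ^ p * β p ^ 2) := by rw [h3]; ring
    _ ≤ C * (2 ^ p * β p ^ 2) := by gcongr

lemma zeta_term_bound (β : ℕ → ℝ) (p : ℕ) (y : ℝ) (hy : |y| < 3 / 2) :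
    ‖(p : ℝ) * ((p : ℝ) - 1) * β p ^ 2 * y ^ (p - 2)‖
      ≤ (p : ℝ) ^ 2 * β p ^ 2 * (3 / 2 : ℝ) ^ p := by
  rcases Nat.eq_zero_or_pos p with rfl | hp
  · simp
  have hp1 : (1 : ℝ) ≤ p := by exact_mod_cast hp
  rw [norm_mul, norm_pow, Real.norm_eq_abs, Real.norm_eq_abs,
    abs_of_nonneg (mul_nonneg (mul_nonneg (by linarith) (by linarith)) (sq_nonneg _))]
  have h1 : |y| ^ (p - 2) ≤ (3 / 2 : ℝ) ^ p :=
    (pow_le_pow_left₀ (abs_nonneg _) hy.le _).trans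
      (pow_le_pow_right₀ (by norm_num) (by omega))
  have h2 : (p : ℝ) * ((p : ℝ) - 1) ≤ (p : ℝ) ^ 2 := by nlinarith
  gcongr

lemma xiD_hasDerivAt {β : ℕ → ℝ} (hβ : ValidBeta β) {s : ℝ} (hs : s ∈ Icc (0 : ℝ) 1) :
    HasDerivAt (xiD β) (zetaFn β s) s := by
  have := hasDerivAt_tsum_of_isPreconnected (𝕜 := ℝ) (F := ℝ)
    (g := fun (p : ℕ) (y : ℝ) => (p : ℝ) * β p ^ 2 * y ^ (p - 1))
    (g' := fun (p : ℕ) (y : ℝ) => (p : ℝ) * ((p : ℝ) - 1) * β p ^ 2 * y ^ (p - 2))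
    (t := Metric.ball 0 (3 / 2)) (y₀ := 0) (y := s) (beta_bound hβ) Metric.isOpen_ball
    (convex_ball _ _).isPreconnected ?_ ?_ (by simp) ?_ ?_
  · exact this
  · intro p y _
    refine ((hasDerivAt_pow (p - 1) y).const_mul ((p : ℝ) * β p ^ 2)).congr_deriv ?_
    rcases Nat.eq_zero_or_pos p with rfl | hp
    · simp
    · rw [Nat.cast_sub hp, Nat.sub_sub]
      push_cast; ring
  · intro p y hy
    exact zeta_term_bound β p y (by simpa using hy)
  · refine summable_of_ne_finset_zero (s := {1}) fun p hp => ?_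
    rcases Nat.eq_zero_or_pos p with rfl | hp0
    · simp
    · have : p ≠ 1 := by simpa using hp
      have : p - 1 ≠ 0 := by omega
      simp [this]
  · simp only [Metric.mem_ball, dist_zero_right, Real.norm_eq_abs]
    rw [abs_of_nonneg hs.1]; linarith [hs.2]

lemma zeta_cont {β : ℕ → ℝ} (hβ : ValidBeta β) : ContinuousOn (zetaFn β) (Icc (0 : ℝ) 1) := by
  refine continuousOn_tsum (fun p => by fun_prop) (beta_bound hβ) fun p y hy => ?_
  refine zeta_term_bound β p y ?_
  rw [abs_of_nonneg hy.1]; linarith [hy.2]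

lemma xiD_mono {β : ℕ → ℝ} (hβ : ValidBeta β) : MonotoneOn (xiD β) (Icc (0 : ℝ) 1) := by
  refine monotoneOn_of_deriv_nonneg (convex_Icc 0 1)
    (fun s hs => (xiD_hasDerivAt hβ hs).continuousAt.continuousWithinAt)
    (fun s hs => (xiD_hasDerivAt hβ (interior_subset hs)).differentiableAt.differentiableWithinAt)
    fun s hs => ?_
  have hs' := interior_subset hs
  rw [(xiD_hasDerivAt hβ hs').deriv]
  refine tsum_nonneg fun p => ?_
  rcases Nat.eq_zero_or_pos p with rfl | hp
  · simp
  have hp1 : (1 : ℝ) ≤ p := by exact_mod_cast hp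
  exact mul_nonneg (mul_nonneg (mul_nonneg (by linarith) (by linarith)) (sq_nonneg _))
    (pow_nonneg hs'.1 _)

/-! ### Distribution functions -/

lemma distF_nonneg (ν : Measure ℝ) (s : ℝ) : 0 ≤ distF ν s := ENNReal.toReal_nonneg

lemma distF_mono {ν : Measure ℝ} (h : MemM ν) : Monotone (distF ν) := fun s t hst => by
  have := h.1
  exact ENNReal.toReal_mono (measure_ne_top _ _) (measure_mono (Icc_subset_Icc_right hst))

lemma distF_le_one {ν : Measure ℝ} (h : MemM ν) (s : ℝ) : distF ν s ≤ 1 := by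
  have := h.1
  exact ENNReal.toReal_le_of_le_ofReal zero_le_one (by simpa using prob_le_one)

lemma distF_one {ν : Measure ℝ} (h : MemM ν) : distF ν 1 = 1 := by
  have := h.1
  have : ν (Icc (0 : ℝ) 1) = 1 := (prob_compl_eq_zero_iff measurableSet_Icc).1 h.2
  simp [distF, this]

lemma atom_mem {ν : Measure ℝ} {S : Finset ℝ} (hS : ν ((S : Set ℝ))ᶜ = 0) {q : ℝ}
    (hq : ν {q} ≠ 0) : q ∈ S := by
  by_contra h
  exact hq (measure_mono_null (by simpa using h) hS)

lemma nextPt_spec {ν : Measure ℝ} (hf : FinSupp ν) {s : ℝ} (hs : s < 1) :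
    s < nextPt ν s ∧ nextPt ν s ≤ 1 ∧ (nextPt ν s = 1 ∨ ν {nextPt ν s} ≠ 0) ∧
      ∀ q, s < q → q ≤ 1 → (ν {q} ≠ 0 ∨ q = 1) → nextPt ν s ≤ q := by
  obtain ⟨S, hS⟩ := hf
  set A : Set ℝ := {q : ℝ | s < q ∧ q ≤ 1 ∧ ν {q} ≠ 0} ∪ {1} with hA
  have hfin : A.Finite := by
    refine Set.Finite.union ?_ (finite_singleton _)
    exact S.finite_toSet.subset fun q hq => atom_mem hS hq.2.2
  have hmem : nextPt ν s ∈ A := (show A.Nonempty from ⟨1, by simp [hA]⟩).csInf_mem hfin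
  have hle : ∀ q ∈ A, nextPt ν s ≤ q := fun q hq => csInf_le hfin.bddBelow hq
  refine ⟨?_, hle 1 (by simp [hA]), ?_, ?_⟩
  · rcases hmem with h | h
    · exact h.1
    · rw [mem_singleton_iff.1 h]; exact hs
  · rcases hmem with h | h
    · exact Or.inr h.2.2
    · exact Or.inl h
  · rintro q h1 h2 (h3 | h3)
    · exact hle q (Or.inl ⟨h1, h2, h3⟩)
    · exact hle q (Or.inr h3)

lemma backward_induction {ν : Measure ℝ} (hf : FinSupp ν) (P : ℝ → Prop) (h1 : P 1)
    (hstep : ∀ s ∈ Ico (0 : ℝ) 1, P (nextPt ν s) → P s) : ∀ s ∈ Icc (0 : ℝ) 1, P s := by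
  obtain ⟨S, hS⟩ := id hf
  have key : ∀ n : ℕ, ∀ s ∈ Icc (0 : ℝ) 1, (S.filter (fun q => s < q)).card ≤ n → P s := by
    intro n
    induction n with
    | zero =>
      intro s hs hc
      rcases eq_or_lt_of_le hs.2 with h | h
      · rw [h]; exact h1
      obtain ⟨a1, a2, a3, a4⟩ := nextPt_spec hf h
      apply hstep s ⟨hs.1, h⟩
      rcases a3 with h3 | h3
      · rw [h3]; exact h1
      · exfalso
        have : nextPt ν s ∈ S.filter (fun q => s < q) :=
          Finset.mem_filter.2 ⟨atom_mem hS h3, a1⟩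
        have := Finset.card_pos.2 ⟨_, this⟩
        omega
    | succ n ih =>
      intro s hs hc
      rcases eq_or_lt_of_le hs.2 with h | h
      · rw [h]; exact h1
      obtain ⟨a1, a2, a3, a4⟩ := nextPt_spec hf h
      apply hstep s ⟨hs.1, h⟩
      rcases a3 with h3 | h3
      · rw [h3]; exact h1
      · apply ih _ ⟨hs.1.trans a1.le, a2⟩
        have hlt : (S.filter (fun q => nextPt ν s < q)).card
            < (S.filter (fun q => s < q)).card := by
          apply Finset.card_lt_card
          refine ⟨fun q hq => ?_, fun hsub => ?_⟩
          · rw [Finset.mem_filter] at hq ⊢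
            exact ⟨hq.1, a1.trans hq.2⟩
          · have : nextPt ν s ∈ S.filter (fun q => s < q) :=
              Finset.mem_filter.2 ⟨atom_mem hS h3, a1⟩
            have := hsub this
            rw [Finset.mem_filter] at this
            exact lt_irrefl _ this.2
        omega
  exact fun s hs => key _ s hs le_rfl

/-! ### Uniform derivative bounds for finitely supported measures -/

lemma HH_lip (j : ℕ) (K : ℝ) : ∃ C : ℝ, 0 ≤ C ∧ ∀ (a : ℕ → ℝ → ℝ) (m m' x : ℝ),
    m ∈ Icc (0 : ℝ) 1 → m' ∈ Icc (0 : ℝ) 1 → (∀ i, 1 ≤ i → i < j → |a i x| ≤ K) →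
    |HH a m j x - HH a m' j x| ≤ C * |m - m'| := by
  by_cases hj : 2 ≤ j ∧ j ≤ 5
  swap
  · refine ⟨0, le_rfl, fun a m m' x _ _ _ => ?_⟩
    have : HH a m j x = HH a m' j x := by
      match j with
      | 0 => rfl
      | 1 => rfl
      | 2 => omega
      | 3 => omega
      | 4 => omega
      | 5 => omega
      | n + 6 => rfl
    simp [this]
  obtain ⟨h2, h5⟩ := hj
  -- a polynomial difference quotient is bounded on compact sets
  have gen : ∀ S : ℝ × ℝ × ℝ × ℝ × ℝ × ℝ → ℝ, Continuous S → ∃ C : ℝ, 0 ≤ C ∧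
      ∀ m m' a1 a2 a3 a4 : ℝ, m ∈ Icc (0 : ℝ) 1 → m' ∈ Icc (0 : ℝ) 1 → |a1| ≤ K → |a2| ≤ K →
        |a3| ≤ K → |a4| ≤ K → |S (m, m', a1, a2, a3, a4)| ≤ C := by
    intro S hS
    obtain ⟨C, hC⟩ := (((isCompact_Icc (a := (0:ℝ)) (b := 1)).prod
      ((isCompact_Icc (a := (0:ℝ)) (b := 1)).prod ((isCompact_Icc (a := -K) (b := K)).prod
      ((isCompact_Icc (a := -K) (b := K)).prod ((isCompact_Icc (a := -K) (b := K)).prod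
      (isCompact_Icc (a := -K) (b := K))))))).exists_bound_of_continuousOn
      (f := S) hS.continuousOn)
    refine ⟨|C|, abs_nonneg _, fun m m' a1 a2 a3 a4 hm hm' k1 k2 k3 k4 => ?_⟩
    have := hC (m, m', a1, a2, a3, a4)
      ⟨hm, hm', abs_le.1 k1, abs_le.1 k2, abs_le.1 k3, abs_le.1 k4⟩
    exact this.trans (le_abs_self C)
  have fin : ∀ {u v d : ℝ} {C : ℝ}, u = d * v → |v| ≤ C → |u| ≤ C * |d| := by
    intro u v d C h hv
    rw [h, abs_mul, mul_comm]; gcongr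
  interval_cases j
  · obtain ⟨C, hC, h⟩ := gen (fun q => q.2.2.1 ^ 2) (by fun_prop)
    refine ⟨C, hC, fun a m m' x hm hm' ha => fin ?_ (h m m' (a 1 x) (a 1 x) (a 1 x) (a 1 x) hm hm'
      (ha 1 le_rfl (by norm_num)) (ha 1 le_rfl (by norm_num)) (ha 1 le_rfl (by norm_num))
      (ha 1 le_rfl (by norm_num)))⟩
    simp only [HH]; ring
  · obtain ⟨C, hC, h⟩ := gen (fun q => 3 * (q.2.2.1 * q.2.2.2.1) + (q.1 + q.2.1) * q.2.2.1 ^ 3)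
      (by fun_prop)
    refine ⟨C, hC, fun a m m' x hm hm' ha => fin ?_ (h m m' (a 1 x) (a 2 x) (a 1 x) (a 1 x) hm hm'
      (ha 1 le_rfl (by norm_num)) (ha 2 (by norm_num) (by norm_num)) (ha 1 le_rfl (by norm_num))
      (ha 1 le_rfl (by norm_num)))⟩
    simp only [HH]; ring
  · obtain ⟨C, hC, h⟩ := gen (fun q => 3 * q.2.2.2.1 ^ 2 + 4 * (q.2.2.1 * q.2.2.2.2.1)
      + 6 * (q.1 + q.2.1) * (q.2.2.1 ^ 2 * q.2.2.2.1)
      + (q.1 ^ 2 + q.1 * q.2.1 + q.2.1 ^ 2) * q.2.2.1 ^ 4)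
      (by fun_prop)
    refine ⟨C, hC, fun a m m' x hm hm' ha => fin ?_ (h m m' (a 1 x) (a 2 x) (a 3 x) (a 1 x) hm hm'
      (ha 1 le_rfl (by norm_num)) (ha 2 (by norm_num) (by norm_num))
      (ha 3 (by norm_num) (by norm_num)) (ha 1 le_rfl (by norm_num)))⟩
    simp only [HH]; ring
  · obtain ⟨C, hC, h⟩ := gen (fun q => 5 * (q.2.2.1 * q.2.2.2.2.2)
      + 10 * (q.2.2.2.1 * q.2.2.2.2.1)
      + 10 * (q.1 + q.2.1) * (q.2.2.1 ^ 2 * q.2.2.2.2.1)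
      + 15 * (q.1 + q.2.1) * (q.2.2.1 * q.2.2.2.1 ^ 2)
      + 10 * (q.1 ^ 2 + q.1 * q.2.1 + q.2.1 ^ 2) * (q.2.2.1 ^ 3 * q.2.2.2.1)
      + (q.1 ^ 3 + q.1 ^ 2 * q.2.1 + q.1 * q.2.1 ^ 2 + q.2.1 ^ 3) * q.2.2.1 ^ 5)
      (by fun_prop)
    refine ⟨C, hC, fun a m m' x hm hm' ha => fin ?_ (h m m' (a 1 x) (a 2 x) (a 3 x) (a 4 x) hm hm'
      (ha 1 le_rfl (by norm_num)) (ha 2 (by norm_num) (by norm_num))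
      (ha 3 (by norm_num) (by norm_num)) (ha 4 (by norm_num) (by norm_num)))⟩
    simp only [HH]; ring

lemma HH_zero (a : ℕ → ℝ → ℝ) (j : ℕ) (x : ℝ) : HH a 0 j x = a j x := by
  match j with
  | 0 => rfl
  | 1 => rfl
  | 2 => simp [HH]
  | 3 => simp [HH]
  | 4 => simp [HH]
  | 5 => simp [HH]
  | n + 6 => rfl

lemma logcosh_jet : ∃ a : ℕ → ℝ → ℝ, IsJet a ∧ a 0 = (fun x => Real.log (Real.cosh x)) ∧
    ∀ j, 1 ≤ j → j ≤ 5 → ∀ x, |HH a 1 j x| ≤ 1 := by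
  let τ : ℝ → ℝ := fun x => Real.sinh x / Real.cosh x
  have hτ : ∀ x, HasDerivAt τ (1 - τ x ^ 2) x := fun x => by
    have hc := (Real.cosh_pos x).ne'
    refine ((Real.hasDerivAt_sinh x).div (Real.hasDerivAt_cosh x) hc).congr_deriv ?_
    simp only [τ]; field_simp
  have hτ1 : ∀ x, |τ x| ≤ 1 := fun x => by
    simp only [τ]
    rw [abs_div, abs_of_pos (Real.cosh_pos x), div_le_one (Real.cosh_pos x)]
    refine abs_le_of_sq_le_sq ?_ (Real.cosh_pos x).le
    nlinarith [Real.cosh_sq x]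
  have h0 : ∀ x, HasDerivAt (fun x => Real.log (Real.cosh x)) (τ x) x := fun x => by
    exact (Real.hasDerivAt_cosh x).log (Real.cosh_pos x).ne'
  refine ⟨fun i => match i with
    | 0 => fun x => Real.log (Real.cosh x) | 1 => τ | 2 => fun x => 1 - τ x ^ 2
    | 3 => fun x => -2 * τ x + 2 * τ x ^ 3
    | 4 => fun x => -2 + 8 * τ x ^ 2 - 6 * τ x ^ 4
    | _ => fun x => (16 * τ x - 24 * τ x ^ 3) * (1 - τ x ^ 2), ?_, rfl, ?_⟩
  · intro i hi x
    interval_cases i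
    · exact h0 x
    · exact hτ x
    · refine (((hτ x).pow 2).const_sub 1).congr_deriv ?_
      norm_num; ring
    · refine (((hτ x).const_mul (-2)).add (((hτ x).pow 3).const_mul 2)).congr_deriv ?_
      norm_num; ring
    · refine (((((hτ x).pow 2).const_mul 8).const_add (-2)).sub
        (((hτ x).pow 4).const_mul 6)).congr_deriv ?_
      norm_num; ring
  · intro j h1 h5 x
    have t := hτ1 x
    interval_cases j
    · exact t
    · have : (1 - τ x ^ 2 + 1 * τ x ^ 2) = 1 := by ring
      simp only [HH]; rw [this]; simp
    · simp only [HH]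
      refine le_of_eq_of_le (congrArg _ ?_) t
      ring
    · simp only [HH]
      refine le_of_eq_of_le (congrArg _ (?_ : _ = (1:ℝ))) (by simp)
      ring
    · simp only [HH]
      refine le_of_eq_of_le (congrArg _ ?_) t
      ring

lemma gStep_eq (β : ℕ → ℝ) (φ : ℝ → ℝ → ℝ) (m t s x : ℝ) :
    gStep β φ m t s x = stepF (φ t) m (Real.sqrt (xiD β t - xiD β s)) x := rfl

/-- uniform bounds -/
lemma uniform_jets : ∃ K : ℝ, 1 ≤ K ∧ ∀ (β : ℕ → ℝ) (ν : Measure ℝ) (φ : ℝ → ℝ → ℝ), MemM ν →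
    FinSupp ν → IsAtomicSol β ν φ → ∀ s ∈ Icc (0 : ℝ) 1, ∃ a : ℕ → ℝ → ℝ, IsJet a ∧ a 0 = φ s ∧
      (∀ x, |a 1 x| ≤ 1) ∧ ∀ j, 1 ≤ j → j ≤ 5 → ∀ x, |a j x| ≤ K := by
  choose C hC0 hC using HH_lip
  let k : ℕ → ℝ := fun n => Nat.rec 1 (fun i r => max r (1 + 2 * C (i + 1) r)) n
  have ks : ∀ n, k (n + 1) = max (k n) (1 + 2 * C (n + 1) (k n)) := fun n => rfl
  have kmono : Monotone k := monotone_nat_of_le_succ fun n => by rw [ks]; exact le_max_left _ _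
  let c : ℕ → ℝ := fun j => if j = 1 then 0 else C j (k (j - 1))
  have c0 : ∀ j, 0 ≤ c j := fun j => by
    simp only [c]; split_ifs
    · exact le_rfl
    · exact hC0 _ _
  have cC : ∀ j, c j ≤ C j (k (j - 1)) := fun j => by
    simp only [c]; split_ifs
    · exact hC0 _ _
    · exact le_rfl
  have lip : ∀ (a : ℕ → ℝ → ℝ) (j : ℕ) (m m' x : ℝ), 1 ≤ j → m ∈ Icc (0 : ℝ) 1 →
      m' ∈ Icc (0 : ℝ) 1 → (∀ i, 1 ≤ i → i < j → |a i x| ≤ k (j - 1)) →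
      |HH a m j x - HH a m' j x| ≤ c j * |m - m'| := by
    intro a j m m' x h1 hm hm' h
    by_cases hj : j = 1
    · subst hj; simp [HH, c]
    · simp only [c, hj, if_false]
      exact hC j (k (j - 1)) a m m' x hm hm' h
  have bd : ∀ (a : ℕ → ℝ → ℝ) (m : ℝ), m ∈ Icc (0 : ℝ) 1 →
      (∀ j, 1 ≤ j → j ≤ 5 → ∀ x, |HH a m j x| ≤ 1 + c j * (1 - m)) →
      ∀ n, ∀ j, 1 ≤ j → j ≤ n → j ≤ 5 → ∀ x, |a j x| ≤ k n := by
    intro a m hm h n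
    induction n with
    | zero => intro j h1 h2; omega
    | succ n ih =>
      intro j h1 h2 h5 x
      rcases Nat.lt_or_ge j (n + 1) with hlt | hge
      · exact (ih j h1 (by omega) h5 x).trans (kmono (Nat.le_succ n))
      · obtain rfl : j = n + 1 := by omega
        have e1 := lip a (n + 1) m 0 x h1 hm ⟨le_rfl, zero_le_one⟩
          (fun i hi1 hi2 => ih i hi1 (by omega) (by omega) x)
        rw [HH_zero, sub_zero, abs_of_nonneg hm.1] at e1
        have e2 := h (n + 1) h1 h5 x
        have e3 := abs_sub_abs_le_abs_sub (a (n + 1) x) (HH a m (n + 1) x)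
        rw [abs_sub_comm] at e3
        have e4 : |a (n + 1) x| ≤ 1 + c (n + 1) := by linarith
        refine e4.trans ?_
        rw [ks]
        refine le_trans ?_ (le_max_right _ _)
        have := cC (n + 1)
        have := hC0 (n + 1) (k n)
        simp only [Nat.add_sub_cancel] at *
        linarith
  refine ⟨k 5, kmono (Nat.zero_le 5), ?_⟩
  intro β ν φ hν hf hφ
  have main : ∀ s ∈ Icc (0 : ℝ) 1, ∃ a : ℕ → ℝ → ℝ, IsJet a ∧ a 0 = φ s ∧
      ∀ j, 1 ≤ j → j ≤ 5 → ∀ x, |HH a (distF ν s) j x| ≤ 1 + c j * (1 - distF ν s) := by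
    apply backward_induction hf
    · obtain ⟨a, h1, h2, h3⟩ := logcosh_jet
      refine ⟨a, h1, ?_, ?_⟩
      · rw [h2]; funext x; rw [hφ.1]
      · rw [distF_one hν]; simpa using h3
    · intro s hs ⟨a, ha, ha0, hab⟩
      obtain ⟨n1, n2, n3, n4⟩ := nextPt_spec hf hs.2
      set t := nextPt ν s with ht
      have hms : distF ν s ∈ Icc (0 : ℝ) 1 := ⟨distF_nonneg _ _, distF_le_one hν _⟩
      have hmt : distF ν t ∈ Icc (0 : ℝ) 1 := ⟨distF_nonneg _ _, distF_le_one hν _⟩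
      have hst : distF ν s ≤ distF ν t := distF_mono hν n1.le
      have ab := bd a _ hmt hab
      have hb : ∀ j, 1 ≤ j → j ≤ 5 → ∀ x, |HH a (distF ν s) j x| ≤ 1 + c j * (1 - distF ν s) := by
        intro j h1 h5 x
        have e1 := lip a j (distF ν s) (distF ν t) x h1 hms hmt
          (fun i hi1 hi2 => ab (j - 1) i hi1 (by omega) (by omega) x)
        have e2 := hab j h1 h5 x
        have e3 := abs_sub_abs_le_abs_sub (HH a (distF ν s) j x) (HH a (distF ν t) j x)
        rw [abs_sub_comm (distF ν s), abs_of_nonneg (sub_nonneg.2 hst)] at e1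
        have : c j * (1 - distF ν s) = c j * (distF ν t - distF ν s) + c j * (1 - distF ν t) := by
          ring
        linarith
      have ha1 : ∀ x, |a 1 x| ≤ 1 := fun x => by
        have := hab 1 le_rfl (by norm_num) x
        simpa [HH, c] using this
      obtain ⟨b, b1, b2, b3⟩ := step_jet ha hms.1 hms.2 (Real.sqrt (xiD β t - xiD β s))
        (1 + c 1 + c 2 + c 3 + c 4 + c 5) ha1 (fun j h1 h5 x => (hb j h1 h5 x).trans (by
          have e1 : c j * (1 - distF ν s) ≤ c j :=
            mul_le_of_le_one_right (c0 j) (by linarith [hms.1])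
          have := c0 1
          have := c0 2
          have := c0 3
          have := c0 4
          have := c0 5
          interval_cases j <;> linarith))
      refine ⟨b, b1, ?_, fun j h1 h5 x => b3 j h1 h5 _ (hb j h1 h5) x⟩
      rw [b2, ha0]; funext x
      rw [hφ.2 s hs x, gStep_eq]
  intro s hs
  obtain ⟨a, h1, h2, h3⟩ := main s hs
  refine ⟨a, h1, h2, fun x => ?_, fun j hj1 hj5 x =>
    bd a _ ⟨distF_nonneg _ _, distF_le_one hν _⟩ h3 5 j hj1 hj5 hj5 x⟩
  have := h3 1 le_rfl (by norm_num) x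
  simpa [HH, c] using this

/-! ### Functions with Lipschitz derivatives up to order four -/

/-- derivatives up to order four exist and are `K`-Lipschitz -/
def Nice (K : ℝ) (f : ℝ → ℝ) : Prop :=
  (∀ i, i < 4 → Differentiable ℝ (iteratedDeriv i f)) ∧
  ∀ i, i ≤ 4 → ∀ x y, |iteratedDeriv i f x - iteratedDeriv i f y| ≤ K * |x - y|

lemma jet_iter {a : ℕ → ℝ → ℝ} (ha : IsJet a) : ∀ i, i ≤ 5 → iteratedDeriv i (a 0) = a i := by
  intro i
  induction i with
  | zero => intro _; simp
  | succ i ih =>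
    intro hi
    rw [iteratedDeriv_succ, ih (by omega)]
    funext x
    exact (ha i (by omega) x).deriv

lemma nice_of_jet {a : ℕ → ℝ → ℝ} (ha : IsJet a) {K : ℝ}
    (hK : ∀ j, 1 ≤ j → j ≤ 5 → ∀ x, |a j x| ≤ K) : Nice K (a 0) := by
  refine ⟨fun i hi x => ?_, fun i hi x y => ?_⟩
  · rw [jet_iter ha i (by omega)]
    exact (ha i (by omega) x).differentiableAt
  · rw [jet_iter ha i (by omega)]
    exact lip_of_deriv (ha i (by omega)) (hK (i + 1) (by omega) (by omega)) x y

lemma Nice.hasDeriv {K : ℝ} {f : ℝ → ℝ} (h : Nice K f) (i : ℕ) (hi : i < 4) (x : ℝ) :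
    HasDerivAt (iteratedDeriv i f) (iteratedDeriv (i + 1) f x) x := by
  rw [iteratedDeriv_succ]
  exact (h.1 i hi x).hasDerivAt

lemma Nice.nonneg {K : ℝ} {f : ℝ → ℝ} (h : Nice K f) : 0 ≤ K := by
  have := (abs_nonneg _).trans (h.2 0 (by norm_num) 1 0)
  simpa using this

lemma Nice.bound {K : ℝ} {f : ℝ → ℝ} (h : Nice K f) (i : ℕ) (h1 : 1 ≤ i) (h4 : i ≤ 4) (x : ℝ) :
    |iteratedDeriv i f x| ≤ K := by
  obtain ⟨j, rfl⟩ : ∃ j, i = j + 1 := ⟨i - 1, by omega⟩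
  rw [iteratedDeriv_succ, ← Real.norm_eq_abs]
  exact norm_deriv_le_of_lip' h.nonneg (Eventually.of_forall fun y => h.2 j (by omega) y x)

lemma interp1 {g h : ℝ → ℝ} (hg : ∀ x, HasDerivAt g (h x) x) {L δ η : ℝ}
    (hL : ∀ x y, |h x - h y| ≤ L * |x - y|) (hδ : ∀ x, |g x| ≤ δ) (hη : 0 < η) (x : ℝ) :
    |h x| ≤ 2 * δ / η + L * η := by
  have hL0 : 0 ≤ L := by
    have := (abs_nonneg _).trans (hL 1 0)
    simpa using this
  obtain ⟨c, hc, hc'⟩ := exists_hasDerivAt_eq_slope g h (show x < x + η by linarith)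
    (fun y _ => (hg y).continuousAt.continuousWithinAt) (fun y _ => hg y)
  have e1 : |h c| ≤ 2 * δ / η := by
    rw [hc', add_sub_cancel_left, abs_div, abs_of_pos hη]
    gcongr
    have := abs_sub (g (x + η)) (g x)
    linarith [hδ (x + η), hδ x]
  have e2 : |h x - h c| ≤ L * η := by
    refine (hL x c).trans ?_
    gcongr
    rw [abs_sub_comm, abs_of_pos (by linarith [hc.1])]
    linarith [hc.2]
  have e3 := abs_sub_abs_le_abs_sub (h x) (h c)
  linarith

lemma interp (K : ℝ) : ∀ i, i ≤ 4 → ∀ ε > 0, ∃ δ > 0, ∀ f g : ℝ → ℝ, Nice K f → Nice K g →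
    (∀ x, |f x - g x| ≤ δ) → ∀ x, |iteratedDeriv i f x - iteratedDeriv i g x| ≤ ε := by
  intro i
  induction i with
  | zero => intro _ ε hε; exact ⟨ε, hε, fun f g _ _ h x => by simpa using h x⟩
  | succ i ih =>
    intro hi ε hε
    set K' := |K| with hK'
    have hK0 : 0 ≤ K' := abs_nonneg _
    set η := ε / (4 * (K' + 1)) with hη
    have hη0 : 0 < η := by positivity
    obtain ⟨δ, hδ, h⟩ := ih (by omega) (ε * η / 4) (by positivity)
    refine ⟨δ, hδ, fun f g hf hg hfg x => ?_⟩
    have := interp1 (g := fun x => iteratedDeriv i f x - iteratedDeriv i g x)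
      (h := fun x => iteratedDeriv (i + 1) f x - iteratedDeriv (i + 1) g x) (L := 2 * K')
      (fun x => (hf.hasDeriv i (by omega) x).sub (hg.hasDeriv i (by omega) x))
      (fun x y => by
        have e1 := hf.2 (i + 1) hi x y
        have e2 := hg.2 (i + 1) hi x y
        have e3 : K * |x - y| ≤ K' * |x - y| := by gcongr; exact le_abs_self K
        rw [abs_le] at e1 e2 ⊢
        constructor <;> linarith)
      (h f g hf hg hfg) hη0 x
    refine this.trans ?_
    have e1 : 2 * (ε * η / 4) / η = ε / 2 := by field_simp; ring
    have e2 : 2 * K' * η ≤ ε / 2 := by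
      rw [hη, mul_div_assoc', div_le_iff₀ (by positivity)]
      nlinarith
    linarith

lemma nice_limit {K : ℝ} {F : ℕ → ℝ → ℝ} {f : ℝ → ℝ} (hF : ∀ n, Nice K (F n))
    (hlim : TendstoUniformly F f atTop) :
    Nice K f ∧ ∀ i, i ≤ 4 →
      TendstoUniformly (fun n => iteratedDeriv i (F n)) (iteratedDeriv i f) atTop := by
  have key : ∀ i, i ≤ 4 →
      TendstoUniformly (fun n => iteratedDeriv i (F n)) (iteratedDeriv i f) atTop ∧
      (∀ j, j < i → Differentiable ℝ (iteratedDeriv j f)) := by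
    intro i
    induction i with
    | zero => intro _; simpa using hlim
    | succ i ih =>
      intro hi
      obtain ⟨ih1, ih2⟩ := ih (by omega)
      have hcau : UniformCauchySeqOn (fun n => iteratedDeriv (i + 1) (F n)) atTop univ := by
        rw [Metric.uniformCauchySeqOn_iff]
        intro ε hε
        obtain ⟨δ, hδ, h⟩ := interp K (i + 1) hi (ε / 2) (by positivity)
        obtain ⟨N, hN⟩ := eventually_atTop.1
          (Metric.tendstoUniformly_iff.1 hlim (δ / 2) (by positivity))
        refine ⟨N, fun n hn m hm x _ => ?_⟩
        rw [Real.dist_eq]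
        refine lt_of_le_of_lt (h (F n) (F m) (hF n) (hF m) (fun y => ?_) x) (by linarith)
        have e1 := hN n hn y
        have e2 := hN m hm y
        rw [Real.dist_eq] at e1 e2
        rw [abs_lt] at e1 e2
        rw [abs_le]
        constructor <;> linarith
      have hpt : ∀ x, ∃ l, Tendsto (fun n => iteratedDeriv (i + 1) (F n) x) atTop (nhds l) :=
        fun x => cauchySeq_tendsto_of_complete (hcau.cauchySeq (mem_univ x))
      choose l hl using hpt
      have hul : TendstoUniformly (fun n => iteratedDeriv (i + 1) (F n)) l atTop := by
        rw [← tendstoUniformlyOn_univ]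
        exact hcau.tendstoUniformlyOn_of_tendsto fun x _ => hl x
      have hd : ∀ x, HasDerivAt (iteratedDeriv i f) (l x) x :=
        hasDerivAt_of_tendstoUniformly hul
          (Eventually.of_forall fun n x => (hF n).hasDeriv i (by omega) x)
          (fun x => ih1.tendsto_at x)
      have hlD : iteratedDeriv (i + 1) f = l := by
        rw [iteratedDeriv_succ]; funext x; exact (hd x).deriv
      refine ⟨by rw [hlD]; exact hul, fun j hj => ?_⟩
      rcases Nat.lt_or_ge j i with h | h
      · exact ih2 j h
      · obtain rfl : j = i := by omega
        exact fun x => (hd x).differentiableAt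
  refine ⟨⟨fun i hi => (key 4 le_rfl).2 i hi, fun i hi x y => ?_⟩, fun i hi => (key i hi).1⟩
  have t1 := (key i hi).1.tendsto_at x
  have t2 := (key i hi).1.tendsto_at y
  exact le_of_tendsto (t1.sub t2).abs (Eventually.of_forall fun n => (hF n).2 i hi x y)

/-! ### Time increments for finitely supported measures -/

/-- first-order time expansion at the next atoms -/
lemma atomic_expand {K : ℝ} (hK : 1 ≤ K) (β : ℕ → ℝ) (hβ : ValidBeta β)
    (hjets : ∀ (ν : Measure ℝ) (φ : ℝ → ℝ → ℝ), MemM ν →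
      FinSupp ν → IsAtomicSol β ν φ → ∀ s ∈ Icc (0 : ℝ) 1, ∃ a : ℕ → ℝ → ℝ, IsJet a ∧ a 0 = φ s ∧
      (∀ x, |a 1 x| ≤ 1) ∧ ∀ j, 1 ≤ j → j ≤ 5 → ∀ x, |a j x| ≤ K)
    (ε : ℝ) (hε : 0 < ε) : ∃ δ > 0, ∀ (ν : Measure ℝ) (φ : ℝ → ℝ → ℝ), MemM ν →
      FinSupp ν → IsAtomicSol β ν φ → ∀ t ∈ Icc (0 : ℝ) 1, (ν {t} ≠ 0 ∨ t = 1) →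
      ∀ s ∈ Icc (0 : ℝ) 1, s ≤ t → xiD β t - xiD β s ≤ δ → ∀ x,
      |φ s x - φ t x - (xiD β t - xiD β s) / 2 *
        (iteratedDeriv 2 (φ t) x + distF ν t * iteratedDeriv 1 (φ t) x ^ 2)|
        ≤ (xiD β t - xiD β s) * (ε + (distF ν t - distF ν s)) := by
  have hmono := xiD_mono hβ
  -- one-step expansion in terms of `φ`
  have one : ∀ ε > 0, ∃ δ > 0, ∀ (ν : Measure ℝ) (φ : ℝ → ℝ → ℝ), MemM ν →
      FinSupp ν → IsAtomicSol β ν φ → ∀ s ∈ Ico (0 : ℝ) 1,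
      xiD β (nextPt ν s) - xiD β s ≤ δ → ∀ x,
      |φ s x - φ (nextPt ν s) x - (xiD β (nextPt ν s) - xiD β s) / 2 *
        (iteratedDeriv 2 (φ (nextPt ν s)) x
          + distF ν s * iteratedDeriv 1 (φ (nextPt ν s)) x ^ 2)|
        ≤ ε * (xiD β (nextPt ν s) - xiD β s) := by
    intro ε hε
    obtain ⟨δ, hδ, h⟩ := step_expand K hK ε hε
    refine ⟨δ ^ 2, by positivity, fun ν φ hν hf hφ s hs hd x => ?_⟩
    obtain ⟨n1, n2, n3, n4⟩ := nextPt_spec hf hs.2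
    set t := nextPt ν s with ht
    have htI : t ∈ Icc (0 : ℝ) 1 := ⟨hs.1.trans n1.le, n2⟩
    obtain ⟨a, ha, ha0, ha1, haK⟩ := hjets ν φ hν hf hφ t htI
    have hv : 0 ≤ xiD β t - xiD β s := sub_nonneg.2 (hmono ⟨hs.1, hs.2.le⟩ htI n1.le)
    have := h a (distF ν s) (Real.sqrt (xiD β t - xiD β s)) ha ha1
      (haK 2 (by norm_num) (by norm_num)) (haK 3 (by norm_num) (by norm_num))
      (distF_nonneg _ _) (distF_le_one hν _) (Real.sqrt_nonneg _)
      (Real.sqrt_le_iff.2 ⟨hδ.le, hd⟩) x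
    rw [Real.sq_sqrt hv] at this
    rw [hφ.2 s hs x, gStep_eq, ← ha0, jet_iter ha 2 (by norm_num), jet_iter ha 1 (by norm_num)]
    exact this
  have hnice : ∀ (ν : Measure ℝ) (φ : ℝ → ℝ → ℝ), MemM ν →
      FinSupp ν → IsAtomicSol β ν φ → ∀ s ∈ Icc (0 : ℝ) 1, Nice K (φ s) := by
    intro ν φ hν hf hφ s hs
    obtain ⟨a, ha, ha0, ha1, haK⟩ := hjets ν φ hν hf hφ s hs
    rw [← ha0]
    exact nice_of_jet ha haK
  have hb1 : ∀ (ν : Measure ℝ) (φ : ℝ → ℝ → ℝ), MemM ν →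
      FinSupp ν → IsAtomicSol β ν φ → ∀ s ∈ Icc (0 : ℝ) 1, ∀ x, |iteratedDeriv 1 (φ s) x| ≤ 1 := by
    intro ν φ hν hf hφ s hs x
    obtain ⟨a, ha, ha0, ha1, haK⟩ := hjets ν φ hν hf hφ s hs
    rw [← ha0, jet_iter ha 1 (by norm_num)]
    exact ha1 x
  -- Lipschitz in time
  obtain ⟨δ1, hδ1, H1⟩ := one 1 one_pos
  have lip : ∀ (ν : Measure ℝ) (φ : ℝ → ℝ → ℝ), MemM ν →
      FinSupp ν → IsAtomicSol β ν φ → ∀ t ∈ Icc (0 : ℝ) 1, (ν {t} ≠ 0 ∨ t = 1) →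
      ∀ s ∈ Icc (0 : ℝ) 1, s ≤ t → xiD β t - xiD β s ≤ δ1 → ∀ x,
      |φ s x - φ t x| ≤ (K + 2) * (xiD β t - xiD β s) := by
    intro ν φ hν hf hφ t htI ht
    apply backward_induction hf
    · intro h1 _ x
      have : t = 1 := le_antisymm htI.2 h1
      subst this; simp
    · intro s hs ih hst hd x
      rcases eq_or_lt_of_le hst with rfl | hlt
      · simp
      obtain ⟨n1, n2, n3, n4⟩ := nextPt_spec hf hs.2
      have hqt := n4 t hlt htI.2 ht
      have step := H1 ν φ hν hf hφ s hs
      set q := nextPt ν s with hq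
      have hqI : q ∈ Icc (0 : ℝ) 1 := ⟨hs.1.trans n1.le, n2⟩
      have hv1 : 0 ≤ xiD β q - xiD β s := sub_nonneg.2 (hmono ⟨hs.1, hs.2.le⟩ hqI n1.le)
      have hv2 : 0 ≤ xiD β t - xiD β q := sub_nonneg.2 (hmono hqI htI hqt)
      have e1 := ih hqt (by linarith) x
      have e2 := step (by linarith) x
      set G := iteratedDeriv 2 (φ q) x + distF ν s * iteratedDeriv 1 (φ q) x ^ 2 with hG
      have hGb : |G| ≤ K + 1 := by
        have t1 := abs_add_le (iteratedDeriv 2 (φ q) x) (distF ν s * iteratedDeriv 1 (φ q) x ^ 2)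
        have t2 := (hnice ν φ hν hf hφ q hqI).bound 2 (by norm_num) (by norm_num) x
        have t3 : |distF ν s * iteratedDeriv 1 (φ q) x ^ 2| ≤ 1 := by
          rw [abs_mul, abs_pow, abs_of_nonneg (distF_nonneg _ _)]
          exact mul_le_one₀ (distF_le_one hν _) (by positivity)
            (pow_le_one₀ (abs_nonneg _) (hb1 ν φ hν hf hφ q hqI x))
        linarith
      have e3 : |(xiD β q - xiD β s) / 2 * G| ≤ (xiD β q - xiD β s) * (K + 1) := by
        rw [abs_mul, abs_of_nonneg (by linarith)]
        have : (xiD β q - xiD β s) / 2 * |G| ≤ (xiD β q - xiD β s) * |G| := by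
          apply mul_le_mul_of_nonneg_right _ (abs_nonneg _); linarith
        exact this.trans (by gcongr)
      rw [abs_le] at e1 e2 e3 ⊢
      constructor <;> nlinarith
  -- small oscillation of the first two derivatives
  obtain ⟨η1, hη1, I1⟩ := interp K 1 (by norm_num) (ε / 8) (by positivity)
  obtain ⟨η2, hη2, I2⟩ := interp K 2 (by norm_num) (ε / 4) (by positivity)
  obtain ⟨δ2, hδ2, H2⟩ := one (ε / 2) (by positivity)
  refine ⟨min (min δ1 δ2) (min (η1 / (K + 2)) (η2 / (K + 2))), by positivity, ?_⟩
  intro ν φ hν hf hφ t htI ht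
  apply backward_induction hf
  · intro h1 _ x
    have : t = 1 := le_antisymm htI.2 h1
    subst this; simp
  · intro s hs ih hst hd x
    rcases eq_or_lt_of_le hst with rfl | hlt
    · simp
    obtain ⟨n1, n2, n3, n4⟩ := nextPt_spec hf hs.2
    have hqt := n4 t hlt htI.2 ht
    have step := H2 ν φ hν hf hφ s hs
    set q := nextPt ν s with hq
    have hqI : q ∈ Icc (0 : ℝ) 1 := ⟨hs.1.trans n1.le, n2⟩
    have hv1 : 0 ≤ xiD β q - xiD β s := sub_nonneg.2 (hmono ⟨hs.1, hs.2.le⟩ hqI n1.le)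
    have hv2 : 0 ≤ xiD β t - xiD β q := sub_nonneg.2 (hmono hqI htI hqt)
    have d1 : xiD β t - xiD β s ≤ δ1 := hd.trans ((min_le_left _ _).trans (min_le_left _ _))
    have d2 : xiD β t - xiD β s ≤ δ2 := hd.trans ((min_le_left _ _).trans (min_le_right _ _))
    have d3 : xiD β t - xiD β s ≤ η1 / (K + 2) :=
      hd.trans ((min_le_right _ _).trans (min_le_left _ _))
    have d4 : xiD β t - xiD β s ≤ η2 / (K + 2) :=
      hd.trans ((min_le_right _ _).trans (min_le_right _ _))
    rw [le_div_iff₀ (by linarith)] at d3 d4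
    have e1 := ih hqt (by linarith) x
    have e2 := step (by linarith) x
    have hlq := lip ν φ hν hf hφ t htI ht q hqI hqt (by linarith)
    have nq := hnice ν φ hν hf hφ q hqI
    have nt := hnice ν φ hν hf hφ t htI
    have o1 := I1 (φ q) (φ t) nq nt (fun y => (hlq y).trans (by nlinarith)) x
    have o2 := I2 (φ q) (φ t) nq nt (fun y => (hlq y).trans (by nlinarith)) x
    have p1 := hb1 ν φ hν hf hφ q hqI x
    have p2 := hb1 ν φ hν hf hφ t htI x
    set A2 := iteratedDeriv 2 (φ q) x
    set A1 := iteratedDeriv 1 (φ q) x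
    set B2 := iteratedDeriv 2 (φ t) x
    set B1 := iteratedDeriv 1 (φ t) x
    set ms := distF ν s
    set mt := distF ν t
    have hms0 : 0 ≤ ms := distF_nonneg _ _
    have hms1 : ms ≤ 1 := distF_le_one hν _
    have hmm : ms ≤ distF ν q := distF_mono hν n1.le
    have hmq : distF ν q ≤ mt := distF_mono hν hqt
    -- compare the two generators
    have cmp : |(A2 + ms * A1 ^ 2) - (B2 + mt * B1 ^ 2)| ≤ ε / 2 + (mt - ms) := by
      have c1 : |ms * (A1 ^ 2 - B1 ^ 2)| ≤ ε / 4 := by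
        have : A1 ^ 2 - B1 ^ 2 = (A1 - B1) * (A1 + B1) := by ring
        rw [abs_mul, abs_of_nonneg hms0, this, abs_mul]
        have q1 : |A1 + B1| ≤ 2 := (abs_add_le _ _).trans (by linarith)
        have q2 : |A1 - B1| * |A1 + B1| ≤ ε / 8 * 2 := by gcongr
        calc ms * (|A1 - B1| * |A1 + B1|) ≤ 1 * (ε / 8 * 2) := by gcongr
          _ = ε / 4 := by ring
      have c2 : |(mt - ms) * B1 ^ 2| ≤ mt - ms := by
        rw [abs_mul, abs_of_nonneg (by linarith), abs_pow]
        exact mul_le_of_le_one_right (by linarith) (pow_le_one₀ (abs_nonneg _) p2)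
      have e : (A2 + ms * A1 ^ 2) - (B2 + mt * B1 ^ 2)
          = (A2 - B2) + ms * (A1 ^ 2 - B1 ^ 2) + -((mt - ms) * B1 ^ 2) := by ring
      rw [e]
      refine (abs_add_three _ _ _).trans ?_
      rw [abs_neg]; linarith
    set G := A2 + ms * A1 ^ 2 with hG
    set F := B2 + mt * B1 ^ 2 with hF
    set v1 := xiD β q - xiD β s with hv1'
    set v2 := xiD β t - xiD β q with hv2'
    have ev : xiD β t - xiD β s = v1 + v2 := by rw [hv1', hv2']; ring
    rw [ev]
    have e3 : |v1 / 2 * (G - F)| ≤ v1 * (ε / 2 + (mt - ms)) := by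
      rw [abs_mul, abs_of_nonneg (by linarith)]
      have : v1 / 2 * |G - F| ≤ v1 * |G - F| := by
        apply mul_le_mul_of_nonneg_right _ (abs_nonneg _); linarith
      exact this.trans (by gcongr)
    have e4 : v2 * (ε + (mt - distF ν q)) ≤ v2 * (ε + (mt - ms)) := by gcongr
    have e : φ s x - φ t x - (v1 + v2) / 2 * F
        = (φ s x - φ q x - v1 / 2 * G) + v1 / 2 * (G - F) + (φ q x - φ t x - v2 / 2 * F) := by
      ring
    rw [e]
    refine (abs_add_three _ _ _).trans ?_
    have : (v1 + v2) * (ε + (mt - ms))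
        = ε / 2 * v1 + v1 * (ε / 2 + (mt - ms)) + v2 * (ε + (mt - ms)) := by ring
    linarith

/-! ### Discretization of a measure -/

lemma discretize (μ : Measure ℝ) (hμ : MemM μ) (hα : ContinuousOn (distF μ) (Icc (0 : ℝ) 1))
    (t : ℝ) (ht : t ∈ Icc (0 : ℝ) 1) (η : ℝ) (hη : 0 < η) :
    ∃ ν : Measure ℝ, MemM ν ∧ FinSupp ν ∧ ν {t} ≠ 0 ∧
      ∀ s ∈ Icc (0 : ℝ) 1, |distF μ s - distF ν s| ≤ η := by
  have huc := isCompact_Icc.uniformContinuousOn_of_continuous hα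
  rw [Metric.uniformContinuousOn_iff] at huc
  obtain ⟨δ, hδ, huc⟩ := huc (η / 2) (by positivity)
  obtain ⟨n, hn⟩ := exists_nat_one_div_lt hδ
  set N : ℝ := (n : ℝ) + 1 with hN
  have hNpos : 0 < N := by positivity
  haveI := hμ.1
  let g : ℝ → ℝ := fun x => (⌈N * x⌉₊ : ℝ) / N
  have hgm : Measurable g := by
    have h1 : Measurable fun x : ℝ => ⌈N * x⌉₊ := Nat.measurable_ceil.comp (measurable_const_mul N)
    have h2 : Measurable fun x : ℝ => ((⌈N * x⌉₊ : ℕ) : ℝ) := measurable_from_nat.comp h1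
    exact h2.div_const N
  have hg0 : ∀ x, 0 ≤ g x := fun x => by positivity
  have hgle : ∀ x, x ≤ g x := fun x => by
    simp only [g]; rw [le_div_iff₀ hNpos, mul_comm]; exact Nat.le_ceil _
  have hgge : ∀ x, 0 ≤ x → g x ≤ x + 1 / N := fun x hx => by
    simp only [g]; rw [div_le_iff₀ hNpos]
    have := Nat.ceil_lt_add_one (show 0 ≤ N * x by positivity)
    have e : (x + 1 / N) * N = N * x + 1 := by field_simp
    rw [e]; exact this.le
  have hceil : ∀ x ∈ Icc (0 : ℝ) 1, ⌈N * x⌉₊ ≤ n + 1 := fun x hx => by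
    apply Nat.ceil_le.2
    push_cast
    nlinarith [hx.2]
  have hg1 : ∀ x ∈ Icc (0 : ℝ) 1, g x ≤ 1 := fun x hx => by
    simp only [g]; rw [div_le_one hNpos]
    have := hceil x hx
    have h : ((⌈N * x⌉₊ : ℕ) : ℝ) ≤ ((n + 1 : ℕ) : ℝ) := by exact_mod_cast this
    simpa [hN] using h
  have hae : ∀ᵐ x ∂μ, x ∈ Icc (0 : ℝ) 1 := by
    rw [ae_iff]; exact hμ.2
  set ρ := μ.map g with hρ
  haveI : IsProbabilityMeasure ρ := Measure.isProbabilityMeasure_map hgm.aemeasurable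
  have hρI : ρ (Icc (0 : ℝ) 1)ᶜ = 0 := by
    rw [hρ, Measure.map_apply hgm measurableSet_Icc.compl]
    refine measure_mono_null ?_ hμ.2
    intro x hx hx'
    exact hx ⟨hg0 x, hg1 x hx'⟩
  have hρd : ∀ s ∈ Icc (0 : ℝ) 1, |distF μ s - distF ρ s| ≤ η / 2 := by
    intro s hs
    have e : distF ρ s = (μ (g ⁻¹' Icc 0 s)).toReal := by
      rw [distF, hρ, Measure.map_apply hgm measurableSet_Icc]
    have up : distF ρ s ≤ distF μ s := by
      rw [e]
      apply ENNReal.toReal_mono (measure_ne_top _ _)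
      apply measure_mono_ae
      filter_upwards [hae] with x hx hx'
      exact ⟨hx.1, (hgle x).trans hx'.2⟩
    set r := max (s - 1 / N) 0 with hr
    have hr0 : 0 ≤ r := le_max_right _ _
    have hrs : r ≤ s := max_le (by have : 0 < 1 / N := by positivity
                                   linarith) hs.1
    have lo : distF μ r ≤ distF ρ s := by
      rw [e]
      apply ENNReal.toReal_mono (measure_ne_top _ _)
      apply measure_mono
      intro x hx
      refine ⟨hg0 x, ?_⟩
      by_cases h : s - 1 / N ≤ 0
      · have hx0 : x = 0 := by
          have := hx.2; rw [hr, max_eq_right h] at this; exact le_antisymm this hx.1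
        simp only [g, hx0]; simpa using hs.1
      · have := hx.2; rw [hr, max_eq_left (le_of_not_ge h)] at this
        have := hgge x hx.1
        linarith
    have hd : dist s r < δ := by
      rw [Real.dist_eq, abs_of_nonneg (by linarith)]
      have : s - 1 / N ≤ r := le_max_left _ _
      linarith
    have := huc s hs r ⟨hr0, hrs.trans hs.2⟩ hd
    rw [Real.dist_eq] at this
    have h2 := (abs_lt.1 this).2
    rw [abs_of_nonneg (by linarith)]
    linarith
  -- mix with a Dirac mass
  set c : ℝ := min 1 (η / 2) with hc
  have hc0 : 0 < c := lt_min one_pos (by positivity)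
  have hc1 : c ≤ 1 := min_le_left _ _
  have hc2 : c ≤ η / 2 := min_le_right _ _
  let ν : Measure ℝ := ENNReal.ofReal (1 - c) • ρ + ENNReal.ofReal c • Measure.dirac t
  have hν : ∀ A, ν A = ENNReal.ofReal (1 - c) * ρ A + ENNReal.ofReal c * Measure.dirac t A := by
    intro A; simp [ν]
  refine ⟨ν, ⟨⟨?_⟩, ?_⟩, ?_, ?_, ?_⟩
  · rw [hν, measure_univ, measure_univ, mul_one, mul_one, ← ENNReal.ofReal_add (by linarith) hc0.le]
    simp
  · rw [hν, hρI, Measure.dirac_apply' _ measurableSet_Icc.compl]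
    simp only [mul_zero, zero_add]
    rw [indicator_of_notMem (by simpa using ht), mul_zero]
  · refine ⟨(Finset.range (n + 2)).image (fun k : ℕ => (k : ℝ) / N) ∪ {t}, ?_⟩
    set S := (Finset.range (n + 2)).image (fun k : ℕ => (k : ℝ) / N) ∪ {t} with hS
    have hSm : MeasurableSet ((S : Set ℝ))ᶜ := S.measurableSet.compl
    rw [hν, Measure.dirac_apply' _ hSm, indicator_of_notMem (by simp [hS]), mul_zero, add_zero]
    have : ρ ((S : Set ℝ))ᶜ = 0 := by
      rw [hρ, Measure.map_apply hgm hSm]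
      refine measure_mono_null ?_ hμ.2
      intro x hx hx'
      apply hx
      simp only [hS, Finset.coe_union, Finset.coe_image, Set.mem_union]
      left
      exact ⟨⌈N * x⌉₊, by simp only [Finset.coe_range, Set.mem_Iio]; have := hceil x hx'; omega, rfl⟩
    rw [this, mul_zero]
  · rw [hν]
    have : Measure.dirac t {t} = 1 := by simp
    rw [this, mul_one]
    intro h
    have := (add_eq_zero.1 h).2
    rw [ENNReal.ofReal_eq_zero] at this
    linarith
  · intro s hs
    have e : distF ν s = (1 - c) * distF ρ s + c * (Measure.dirac t (Icc 0 s)).toReal := by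
      simp only [distF]
      rw [hν, ENNReal.toReal_add (by finiteness) (by finiteness), ENNReal.toReal_mul,
        ENNReal.toReal_mul, ENNReal.toReal_ofReal (by linarith), ENNReal.toReal_ofReal hc0.le]
    have h1 := distF_le_one (ν := ρ) ⟨inferInstance, hρI⟩ s
    have h0 := distF_nonneg ρ s
    have d1 : (Measure.dirac t (Icc 0 s)).toReal ≤ 1 := by
      have := prob_le_one (μ := Measure.dirac t) (s := Icc 0 s)
      simpa using ENNReal.toReal_mono ENNReal.one_ne_top this
    have d0 : 0 ≤ (Measure.dirac t (Icc 0 s)).toReal := ENNReal.toReal_nonneg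
    have h2 := abs_le.1 (hρd s hs)
    rw [e, abs_le]
    constructor <;> nlinarith

/-- quantitative bound on the metric -/
lemma dM_le (μ ν : Measure ℝ) (η : ℝ)
    (h : ∀ s ∈ Icc (0 : ℝ) 1, |distF μ s - distF ν s| ≤ η) : dM μ ν ≤ η := by
  have := intervalIntegral.norm_integral_le_of_norm_le_const (a := (0 : ℝ)) (b := 1)
    (f := fun s => |distF μ s - distF ν s|) (C := η) (fun s hs => by
      rw [uIoc_of_le zero_le_one] at hs
      simpa using h s ⟨hs.1.le, hs.2⟩)
  simp only [sub_zero, abs_one, mul_one] at this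
  exact (le_abs_self _).trans this

/-- approximating sequence -/
lemma approx_seq {β : ℕ → ℝ} {Φ : Measure ℝ → ℝ → ℝ → ℝ} (hΦ : IsParisiFamily β Φ)
    {μ : Measure ℝ} (hμ : MemM μ) (hα : ContinuousOn (distF μ) (Icc (0 : ℝ) 1))
    (t : ℝ) (ht : t ∈ Icc (0 : ℝ) 1) :
    ∃ ν : ℕ → Measure ℝ, (∀ n, MemM (ν n) ∧ FinSupp (ν n) ∧ ν n {t} ≠ 0) ∧
      (∀ s ∈ Icc (0 : ℝ) 1, Tendsto (fun n => distF (ν n) s) atTop (nhds (distF μ s))) ∧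
      ∀ s ∈ Icc (0 : ℝ) 1, TendstoUniformly (fun n => Φ (ν n) s) (Φ μ s) atTop := by
  have h := fun n : ℕ => discretize μ hμ hα t ht (1 / ((n : ℝ) + 1)) (by positivity)
  choose ν h1 h2 h3 h4 using h
  refine ⟨ν, fun n => ⟨h1 n, h2 n, h3 n⟩, ?_, ?_⟩
  · intro s hs
    rw [tendsto_iff_norm_sub_tendsto_zero]
    refine squeeze_zero (fun _ => norm_nonneg _) (fun n => ?_) tendsto_one_div_add_atTop_nhds_zero_nat
    rw [norm_sub_rev]; exact h4 n s hs
  · intro s hs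
    rw [Metric.tendstoUniformly_iff]
    intro ε hε
    obtain ⟨δ, hδ, hd⟩ := hΦ.2 μ hμ ε hε
    have : ∀ᶠ n : ℕ in atTop, 1 / ((n : ℝ) + 1) < δ :=
      tendsto_one_div_add_atTop_nhds_zero_nat.eventually (gt_mem_nhds hδ)
    filter_upwards [this] with n hn x
    rw [Real.dist_eq]
    exact hd (ν n) (h1 n) ((dM_le _ _ _ (h4 n)).trans_lt hn) s hs x

/-! ### Passing to the limit -/

lemma limit_facts {β : ℕ → ℝ} (hβ : ValidBeta β) {Φ : Measure ℝ → ℝ → ℝ → ℝ}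
    (hΦ : IsParisiFamily β Φ)
    {μ : Measure ℝ} (hμ : MemM μ) (hα : ContinuousOn (distF μ) (Icc (0 : ℝ) 1)) :
    ∃ K : ℝ, 1 ≤ K ∧ (∀ s ∈ Icc (0 : ℝ) 1, Nice K (Φ μ s)) ∧
      (∀ x, Φ μ 1 x = Real.log (Real.cosh x)) ∧
      ∀ ε > 0, ∃ δ > 0, ∀ t ∈ Icc (0 : ℝ) 1, ∀ s ∈ Icc (0 : ℝ) 1, s ≤ t →
        xiD β t - xiD β s ≤ δ → ∀ x,
        |Φ μ s x - Φ μ t x - (xiD β t - xiD β s) / 2 *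
          (iteratedDeriv 2 (Φ μ t) x + distF μ t * iteratedDeriv 1 (Φ μ t) x ^ 2)|
        ≤ (xiD β t - xiD β s) * (ε + (distF μ t - distF μ s)) := by
  obtain ⟨K, hK, hj⟩ := uniform_jets
  have hnice : ∀ ν, MemM ν → FinSupp ν → ∀ s ∈ Icc (0 : ℝ) 1, Nice K (Φ ν s) := by
    intro ν h1 h2 s hs
    obtain ⟨a, ha, ha0, -, hb⟩ := hj β ν (Φ ν) h1 h2 (hΦ.1 ν h1 h2) s hs
    rw [← ha0]
    exact nice_of_jet ha hb
  refine ⟨K, hK, ?_, ?_, ?_⟩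
  · intro s hs
    obtain ⟨ν, h1, -, h3⟩ := approx_seq hΦ hμ hα s hs
    exact (nice_limit (fun n => hnice (ν n) (h1 n).1 (h1 n).2.1 s hs) (h3 s hs)).1
  · intro x
    obtain ⟨ν, h1, -, h3⟩ := approx_seq hΦ hμ hα 1 (by simp)
    have h := (h3 1 (by simp)).tendsto_at x
    have h' : (fun n => Φ (ν n) 1 x) = fun _ => Real.log (Real.cosh x) := by
      funext n; exact (hΦ.1 (ν n) (h1 n).1 (h1 n).2.1).1 x
    rw [h'] at h
    exact tendsto_nhds_unique h tendsto_const_nhds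
  · intro ε hε
    obtain ⟨δ, hδ, H⟩ := atomic_expand hK β hβ (hj β) ε hε
    refine ⟨δ, hδ, ?_⟩
    intro t ht s hs hst hv x
    obtain ⟨ν, h1, h2, h3⟩ := approx_seq hΦ hμ hα t ht
    have hl := (nice_limit (fun n => hnice (ν n) (h1 n).1 (h1 n).2.1 t ht) (h3 t ht)).2
    have l1 := (hl 1 (by norm_num)).tendsto_at x
    have l2 := (hl 2 (by norm_num)).tendsto_at x
    refine le_of_tendsto_of_tendsto'
      ((((h3 s hs).tendsto_at x).sub ((h3 t ht).tendsto_at x)).sub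
        (tendsto_const_nhds.mul (l2.add ((h2 t ht).mul (l1.pow 2))))).abs
      (tendsto_const_nhds.mul (tendsto_const_nhds.add ((h2 t ht).sub (h2 s hs)))) ?_
    intro n
    exact H (ν n) (Φ (ν n)) (h1 n).1 (h1 n).2.1 (hΦ.1 _ (h1 n).1 (h1 n).2.1) t ht
      (Or.inl (h1 n).2.2) s hs hst hv x

/-! ### Exchange of time and space derivatives -/

lemma mixed_partials {u G ux Gx : ℝ → ℝ → ℝ}
    (hu : ∀ x, ∀ s ∈ Icc (0 : ℝ) 1, HasDerivWithinAt (fun r => u r x) (G s x) (Icc 0 1) s)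
    (hux : ∀ s ∈ Icc (0 : ℝ) 1, ∀ x, HasDerivAt (u s) (ux s x) x)
    (hGx : ∀ s ∈ Icc (0 : ℝ) 1, ∀ x, HasDerivAt (G s) (Gx s x) x)
    (hc : ContinuousOn (fun p : ℝ × ℝ => Gx p.1 p.2) (Icc (0 : ℝ) 1 ×ˢ (univ : Set ℝ))) :
    ∀ x, ∀ s ∈ Icc (0 : ℝ) 1, HasDerivWithinAt (fun r => ux r x) (Gx s x) (Icc 0 1) s := by
  intro x s hs
  rw [hasDerivWithinAt_iff_isLittleO, Asymptotics.isLittleO_iff]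
  intro ε hε
  have hcs := Metric.continuousWithinAt_iff.1 (hc (s, x) ⟨hs, mem_univ _⟩) ε hε
  obtain ⟨δ, hδ, hb⟩ := hcs
  have hb' : ∀ r ∈ Icc (0 : ℝ) 1, |r - s| < δ → ∀ y, |y - x| < δ → |Gx r y - Gx s x| ≤ ε := by
    intro r hr h1 y h2
    have := hb (x := (r, y)) ⟨hr, mem_univ _⟩ (by
      rw [Prod.dist_eq]; exact max_lt h1 h2)
    exact this.le
  have hnear : ∀ᶠ t in nhdsWithin s (Icc (0 : ℝ) 1), |t - s| < δ :=
    mem_nhdsWithin_of_mem_nhds (Metric.ball_mem_nhds s hδ)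
  filter_upwards [hnear, self_mem_nhdsWithin] with t ht htI
  -- Lipschitz bound of an auxiliary function near `x`
  have key : ∀ y, |y - x| < δ →
      |(u t y - u s y - (t - s) * Gx s x * y) - (u t x - u s x - (t - s) * Gx s x * x)|
        ≤ ε * |t - s| * |y - x| := by
    intro y hy
    have hG : ∀ r ∈ Icc (0 : ℝ) 1, |r - s| < δ →
        |(G r y - Gx s x * y) - (G r x - Gx s x * x)| ≤ ε * |y - x| := by
      intro r hr hrs
      refine Convex.norm_image_sub_le_of_norm_hasDerivWithin_le
        (f := fun z => G r z - Gx s x * z) (f' := fun z => Gx r z - Gx s x)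
        (s := Metric.ball x δ) (fun z hz => ?_) (fun z hz => ?_) (convex_ball x δ)
        (Metric.mem_ball_self hδ) hy
      · have := (hGx r hr z).sub ((hasDerivAt_id z).const_mul (Gx s x))
        simp only [mul_one] at this
        exact this.hasDerivWithinAt
      · exact hb' r hr hrs z hz
    have := Convex.norm_image_sub_le_of_norm_hasDerivWithin_le
        (f := fun r => u r y - u r x - r * (Gx s x * (y - x)))
        (f' := fun r => G r y - G r x - Gx s x * (y - x)) (C := ε * |y - x|)
        (s := Icc (0 : ℝ) 1 ∩ Metric.ball s δ) (x := s) (y := t) (fun r hr => ?_) (fun r hr => ?_)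
        ((convex_Icc _ _).inter (convex_ball s δ)) ⟨hs, Metric.mem_ball_self hδ⟩ ⟨htI, ht⟩
    · rw [Real.norm_eq_abs, Real.norm_eq_abs] at this
      calc _ = |u t y - u t x - t * (Gx s x * (y - x)) - (u s y - u s x - s * (Gx s x * (y - x)))| := by
            congr 1; ring
        _ ≤ _ := this
        _ = _ := by ring
    · have h := ((hu y r hr.1).sub (hu x r hr.1)).sub
        ((hasDerivWithinAt_id r (Icc (0 : ℝ) 1)).mul_const (Gx s x * (y - x)))
      simp only [one_mul] at h
      exact h.mono inter_subset_left
    · have := hG r hr.1 hr.2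
      rw [Real.norm_eq_abs]
      convert this using 2
      ring
  have hd : HasDerivAt (fun y => u t y - u s y - (t - s) * Gx s x * y)
      (ux t x - ux s x - (t - s) * Gx s x) x := by
    have := ((hux t htI x).sub (hux s hs x)).sub
      ((hasDerivAt_id x).const_mul ((t - s) * Gx s x))
    simp only [mul_one] at this
    exact this
  have := hd.le_of_lip' (C := ε * |t - s|) (by positivity) (by
    have : ∀ᶠ y in nhds x, |y - x| < δ := Metric.ball_mem_nhds x hδ
    filter_upwards [this] with y hy
    exact key y hy)
  simpa using this

/-! ### Regularity in the abstract setting -/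

lemma Nice.contDiff {K : ℝ} {f : ℝ → ℝ} (h : Nice K f) (j : ℕ) (hj : j ≤ 2) :
    ContDiff ℝ 2 (iteratedDeriv j f) := by
  have e : ∀ m, iteratedDeriv m (iteratedDeriv j f) = iteratedDeriv (m + j) f := by
    intro m
    simp only [iteratedDeriv_eq_iterate, Function.iterate_add_apply]
  have : ContDiff ℝ ((2 : ℕ) : WithTop ℕ∞) (iteratedDeriv j f) := by
    rw [contDiff_nat_iff_iteratedDeriv]
    refine ⟨fun m hm => ?_, fun m hm => ?_⟩
    · rw [e]
      have hK := h.nonneg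
      have := h.2 (m + j) (by omega)
      exact (LipschitzWith.of_dist_le_mul (K := ⟨K, hK⟩) (fun x y => by
        rw [Real.dist_eq, Real.dist_eq]; exact this x y)).continuous
    · rw [e]
      exact h.1 (m + j) (by omega)
  exact_mod_cast this

lemma abstract_reg {K : ℝ} (hK : 1 ≤ K) {u : ℝ → ℝ → ℝ} {α X Z : ℝ → ℝ}
    (hN : ∀ s ∈ Icc (0 : ℝ) 1, Nice K (u s))
    (hα : ContinuousOn α (Icc (0 : ℝ) 1)) (hα0 : ∀ s, 0 ≤ α s) (hα1 : ∀ s, α s ≤ 1)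
    (hX : ∀ s ∈ Icc (0 : ℝ) 1, HasDerivAt X (Z s) s) (hZ : ContinuousOn Z (Icc (0 : ℝ) 1))
    (hmono : MonotoneOn X (Icc (0 : ℝ) 1))
    (hexp : ∀ ε > 0, ∃ δ > 0, ∀ t ∈ Icc (0 : ℝ) 1, ∀ s ∈ Icc (0 : ℝ) 1, s ≤ t →
        X t - X s ≤ δ → ∀ x,
        |u s x - u t x - (X t - X s) / 2 *
          (iteratedDeriv 2 (u t) x + α t * iteratedDeriv 1 (u t) x ^ 2)|
        ≤ (X t - X s) * (ε + (α t - α s))) :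
    (∀ i ≤ 4, ContinuousOn (fun p : ℝ × ℝ => iteratedDeriv i (u p.1) p.2)
      (Icc (0 : ℝ) 1 ×ˢ (univ : Set ℝ))) ∧
    ∀ x, ∀ s ∈ Icc (0 : ℝ) 1, HasDerivWithinAt (fun r => u r x)
      (-(Z s / 2) * (iteratedDeriv 2 (u s) x + α s * iteratedDeriv 1 (u s) x ^ 2))
      (Icc 0 1) s := by
  have hXc : ContinuousOn X (Icc (0 : ℝ) 1) := fun s hs => (hX s hs).continuousAt.continuousWithinAt
  have hXnear : ∀ s ∈ Icc (0 : ℝ) 1, ∀ δ > 0,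
      ∀ᶠ r in nhdsWithin s (Icc (0 : ℝ) 1), |X r - X s| < δ := fun s hs δ hδ =>
    (hXc s hs).eventually (Metric.ball_mem_nhds (X s) hδ)
  have hFb : ∀ s ∈ Icc (0 : ℝ) 1, ∀ x,
      |iteratedDeriv 2 (u s) x + α s * iteratedDeriv 1 (u s) x ^ 2| ≤ K + K ^ 2 := by
    intro s hs x
    have h1 := (hN s hs).bound 1 le_rfl (by norm_num) x
    have h2 := (hN s hs).bound 2 (by norm_num) (by norm_num) x
    have h3 : iteratedDeriv 1 (u s) x ^ 2 ≤ K ^ 2 := sq_le_sq' (abs_le.1 h1).1 (abs_le.1 h1).2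
    have h4 : |α s * iteratedDeriv 1 (u s) x ^ 2| ≤ K ^ 2 := by
      rw [abs_of_nonneg (mul_nonneg (hα0 s) (sq_nonneg _))]
      nlinarith [hα0 s, hα1 s, sq_nonneg (iteratedDeriv 1 (u s) x)]
    exact (abs_add_le _ _).trans (add_le_add h2 h4)
  -- time continuity, uniform in space
  have htime : ∀ s ∈ Icc (0 : ℝ) 1, ∀ η > 0,
      ∀ᶠ r in nhdsWithin s (Icc (0 : ℝ) 1), ∀ x, |u r x - u s x| ≤ η := by
    intro s hs η hη
    obtain ⟨δ, hδ, H⟩ := hexp 1 one_pos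
    have C : 0 < K + K ^ 2 + 2 := by positivity
    have H' : ∀ t ∈ Icc (0 : ℝ) 1, ∀ s ∈ Icc (0 : ℝ) 1, s ≤ t → X t - X s ≤ δ → ∀ x,
        |u s x - u t x| ≤ (X t - X s) * (K + K ^ 2 + 2) := by
      intro t ht s hs hst hv x
      have h := abs_le.1 (H t ht s hs hst hv x)
      have hF := abs_le.1 (hFb t ht x)
      have v0 : 0 ≤ X t - X s := sub_nonneg.2 (hmono hs ht hst)
      have a1 : (X t - X s) * (1 + (α t - α s)) ≤ (X t - X s) * 2 :=
        mul_le_mul_of_nonneg_left (by linarith [hα0 s, hα1 t]) v0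
      have a2 := mul_le_mul_of_nonneg_left hF.1 v0
      have a3 := mul_le_mul_of_nonneg_left hF.2 v0
      have a4 : 0 ≤ (X t - X s) * (K + K ^ 2) := by positivity
      rw [abs_le]
      constructor <;> nlinarith
    filter_upwards [hXnear s hs _ (lt_min hδ (div_pos hη C)), self_mem_nhdsWithin] with r hr hrI x
    have hr1 : |X r - X s| ≤ δ := hr.le.trans (min_le_left _ _)
    have hr2 : |X r - X s| * (K + K ^ 2 + 2) ≤ η := by
      rw [← le_div_iff₀ C]; exact hr.le.trans (min_le_right _ _)
    rcases le_total r s with h | h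
    · have v0 : 0 ≤ X s - X r := sub_nonneg.2 (hmono hrI hs h)
      rw [abs_sub_comm, abs_of_nonneg v0] at hr1 hr2
      exact (H' s hs r hrI h hr1 x).trans hr2
    · have v0 : 0 ≤ X r - X s := sub_nonneg.2 (hmono hs hrI h)
      rw [abs_of_nonneg v0] at hr1 hr2
      rw [abs_sub_comm]
      exact (H' r hrI s hs h hr1 x).trans hr2
  have hcont : ∀ i ≤ 4, ContinuousOn (fun p : ℝ × ℝ => iteratedDeriv i (u p.1) p.2)
      (Icc (0 : ℝ) 1 ×ˢ (univ : Set ℝ)) := by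
    rintro i hi ⟨s, x⟩ ⟨hs, -⟩
    simp only at hs
    rw [Metric.continuousWithinAt_iff']
    intro ε hε
    obtain ⟨δ, hδ, H⟩ := interp K i hi (ε / 3) (by positivity)
    have e1 : ∀ᶠ p : ℝ × ℝ in nhdsWithin (s, x) (Icc (0 : ℝ) 1 ×ˢ (univ : Set ℝ)),
        ∀ y, |u p.1 y - u s y| ≤ δ := by
      rw [nhdsWithin_prod_eq]
      exact (tendsto_fst).eventually (htime s hs δ hδ)
    have e2 : ∀ᶠ p : ℝ × ℝ in nhdsWithin (s, x) (Icc (0 : ℝ) 1 ×ˢ (univ : Set ℝ)),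
        |p.2 - x| < ε / (3 * K) := by
      have : ∀ᶠ p : ℝ × ℝ in nhds (s, x), |p.2 - x| < ε / (3 * K) :=
        (continuous_snd.tendsto (s, x)).eventually
          (Metric.ball_mem_nhds x (by positivity : 0 < ε / (3 * K)))
      exact mem_nhdsWithin_of_mem_nhds this
    filter_upwards [e1, e2, self_mem_nhdsWithin] with p h1 h2 hp
    have a1 := H (u p.1) (u s) (hN _ hp.1) (hN s hs) h1 p.2
    have a2 := (hN s hs).2 i hi p.2 x
    have a3 : K * |p.2 - x| ≤ ε / 3 := by
      rw [lt_div_iff₀ (by positivity)] at h2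
      linarith
    rw [Real.dist_eq]
    have := abs_sub_le (iteratedDeriv i (u p.1) p.2) (iteratedDeriv i (u s) p.2)
      (iteratedDeriv i (u s) x)
    linarith
  refine ⟨hcont, ?_⟩
  intro x s hs
  set F : ℝ → ℝ := fun r => iteratedDeriv 2 (u r) x + α r * iteratedDeriv 1 (u r) x ^ 2 with hF
  have hcx : ∀ i ≤ 4, ContinuousOn (fun r => iteratedDeriv i (u r) x) (Icc (0 : ℝ) 1) := by
    intro i hi
    exact (hcont i hi).comp (f := fun r : ℝ => (r, x)) (by fun_prop) (fun r hr => ⟨hr, mem_univ _⟩)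
  have hFc : ContinuousOn F (Icc (0 : ℝ) 1) :=
    (hcx 2 (by norm_num)).add (hα.mul ((hcx 1 (by norm_num)).pow 2))
  have o1 : (fun r => u r x - u s x + (X r - X s) / 2 * F s)
      =o[nhdsWithin s (Icc (0 : ℝ) 1)] fun r => X r - X s := by
    rw [Asymptotics.isLittleO_iff]
    intro ε hε
    obtain ⟨δ, hδ, H⟩ := hexp (ε / 3) (by positivity)
    have eα : ∀ᶠ r in nhdsWithin s (Icc (0 : ℝ) 1), |α r - α s| < ε / 3 :=
      (hα s hs).eventually (Metric.ball_mem_nhds (α s) (by positivity))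
    have eF : ∀ᶠ r in nhdsWithin s (Icc (0 : ℝ) 1), |F r - F s| < ε / 3 :=
      (hFc s hs).eventually (Metric.ball_mem_nhds (F s) (by positivity))
    filter_upwards [hXnear s hs δ hδ, eα, eF, self_mem_nhdsWithin] with r h1 h2 h3 hrI
    rw [Real.norm_eq_abs, Real.norm_eq_abs]
    have h2 := abs_lt.1 h2
    have h3 := abs_lt.1 h3
    rcases le_total r s with h | h
    · have v0 : 0 ≤ X s - X r := sub_nonneg.2 (hmono hrI hs h)
      rw [abs_sub_comm (X r), abs_of_nonneg v0] at h1 ⊢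
      have := H s hs r hrI h h1.le x
      have a1 : (X s - X r) * (ε / 3 + (α s - α r)) ≤ ε * (X s - X r) := by
        rw [mul_comm ε]; exact mul_le_mul_of_nonneg_left (by linarith) v0
      calc _ = |u r x - u s x - (X s - X r) / 2 * F s| := by congr 1; ring
        _ ≤ _ := this.trans a1
    · have v0 : 0 ≤ X r - X s := sub_nonneg.2 (hmono hs hrI h)
      rw [abs_of_nonneg v0] at h1 ⊢
      have := abs_le.1 (H r hrI s hs h h1.le x)
      have a1 : (X r - X s) * (ε / 3 + (α r - α s)) ≤ (X r - X s) * (ε * (2 / 3)) :=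
        mul_le_mul_of_nonneg_left (by linarith) v0
      have a2 : (X r - X s) * (F r - F s) ≤ (X r - X s) * (ε / 3) :=
        mul_le_mul_of_nonneg_left (by linarith) v0
      have a3 : (X r - X s) * (-(ε / 3)) ≤ (X r - X s) * (F r - F s) :=
        mul_le_mul_of_nonneg_left (by linarith) v0
      have a4 : 0 ≤ (X r - X s) * ε := by positivity
      have e : iteratedDeriv 2 (u r) x + α r * iteratedDeriv 1 (u r) x ^ 2 = F r := rfl
      rw [e] at this
      rw [abs_le]
      constructor <;> nlinarith
  have hXs := (hX s hs).hasDerivWithinAt (s := Icc (0 : ℝ) 1)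
  have hXO : (fun r => X r - X s) =O[nhdsWithin s (Icc (0 : ℝ) 1)] fun r => r - s :=
    hXs.hasFDerivWithinAt.isBigO_sub
  have o2 := o1.trans_isBigO hXO
  have o3 := (hasDerivWithinAt_iff_isLittleO.1 hXs).const_mul_left (F s / 2)
  rw [hasDerivWithinAt_iff_isLittleO]
  refine (o2.sub o3).congr_left fun r => ?_
  simp only [smul_eq_mul, hF]
  ring

/-- **Proposition 2(iii) + classical solvability of the Parisi PDE.** If the
distribution function `α` of `μ ∈ 𝓜` is continuous on `[0,1]`, then `Φ_μ`,
`∂ₓΦ_μ` and `∂ₓₓΦ_μ` are of class `C^{1,2}`, and `Φ_μ` solves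
`∂ₛΦ_μ = -(ζ(s)/2)(∂ₓₓΦ_μ + α(s)(∂ₓΦ_μ)²)` with `Φ_μ(1,x) = log cosh x`. -/
theorem stmt11 (β : ℕ → ℝ) (hβ : ValidBeta β)
    (Φ : Measure ℝ → ℝ → ℝ → ℝ) (hΦ : IsParisiFamily β Φ)
    (μ : Measure ℝ) (hμ : MemM μ)
    (hα : ContinuousOn (distF μ) (Icc (0 : ℝ) 1)) :
    MemC12 (Φ μ) ∧
    MemC12 (fun s x => deriv (Φ μ s) x) ∧
    MemC12 (fun s x => iteratedDeriv 2 (Φ μ s) x) ∧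
    (∀ x : ℝ, Φ μ 1 x = Real.log (Real.cosh x)) ∧
    (∀ s ∈ Ico (0 : ℝ) 1, ∀ x : ℝ,
      HasDerivWithinAt (fun r => Φ μ r x)
        (-(zetaFn β s / 2) *
          (iteratedDeriv 2 (Φ μ s) x + distF μ s * (deriv (Φ μ s) x) ^ 2))
        (Icc (0 : ℝ) 1) s) := by
  obtain ⟨K, hK, hN, hterm, hexp⟩ := limit_facts hβ hΦ hμ hα
  obtain ⟨hc, hd⟩ := abstract_reg hK hN hα (distF_nonneg μ) (distF_le_one hμ)
    (fun s hs => xiD_hasDerivAt hβ hs) (zeta_cont hβ) (xiD_mono hβ) hexp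
  have hfst : ∀ {f : ℝ → ℝ}, ContinuousOn f (Icc (0 : ℝ) 1) →
      ContinuousOn (fun p : ℝ × ℝ => f p.1) (Icc (0 : ℝ) 1 ×ˢ (univ : Set ℝ)) :=
    fun hf => hf.comp continuousOn_fst (fun p hp => hp.1)
  have cz := hfst ((zeta_cont hβ).div_const 2).neg
  have ca := hfst hα
  have c1 := hc 1 (by norm_num)
  have c2 := hc 2 (by norm_num)
  have c3 := hc 3 (by norm_num)
  have c4 := hc 4 (by norm_num)
  -- space derivatives
  have hb := fun s hs i hi x => (hN s hs).hasDeriv i hi x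
  -- time derivatives of the space derivatives
  have cG0 : ContinuousOn (fun p : ℝ × ℝ => -(zetaFn β p.1 / 2) *
      (iteratedDeriv 2 (Φ μ p.1) p.2 + distF μ p.1 * iteratedDeriv 1 (Φ μ p.1) p.2 ^ 2))
      (Icc (0 : ℝ) 1 ×ˢ (univ : Set ℝ)) := cz.mul (c2.add (ca.mul (c1.pow 2)))
  have cG1 : ContinuousOn (fun p : ℝ × ℝ => -(zetaFn β p.1 / 2) *
      (iteratedDeriv 3 (Φ μ p.1) p.2 + distF μ p.1 *
        (2 * (iteratedDeriv 1 (Φ μ p.1) p.2 * iteratedDeriv 2 (Φ μ p.1) p.2))))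
      (Icc (0 : ℝ) 1 ×ˢ (univ : Set ℝ)) :=
    cz.mul (c3.add (ca.mul (continuousOn_const.mul (c1.mul c2))))
  have cG2 : ContinuousOn (fun p : ℝ × ℝ => -(zetaFn β p.1 / 2) *
      (iteratedDeriv 4 (Φ μ p.1) p.2 + distF μ p.1 *
        (2 * (iteratedDeriv 2 (Φ μ p.1) p.2 * iteratedDeriv 2 (Φ μ p.1) p.2 +
          iteratedDeriv 1 (Φ μ p.1) p.2 * iteratedDeriv 3 (Φ μ p.1) p.2))))
      (Icc (0 : ℝ) 1 ×ˢ (univ : Set ℝ)) :=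
    cz.mul (c4.add (ca.mul (continuousOn_const.mul ((c2.mul c2).add (c1.mul c3)))))
  have d1 := mixed_partials (u := fun s x => iteratedDeriv 0 (Φ μ s) x)
    (ux := fun s x => iteratedDeriv 1 (Φ μ s) x)
    (G := fun s x => -(zetaFn β s / 2) *
      (iteratedDeriv 2 (Φ μ s) x + distF μ s * iteratedDeriv 1 (Φ μ s) x ^ 2))
    (Gx := fun s x => -(zetaFn β s / 2) * (iteratedDeriv 3 (Φ μ s) x + distF μ s *
        (2 * (iteratedDeriv 1 (Φ μ s) x * iteratedDeriv 2 (Φ μ s) x))))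
    (fun x s hs => by simpa only [iteratedDeriv_zero] using hd x s hs)
    (fun s hs x => hb s hs 0 (by norm_num) x)
    (fun s hs x => by
      have h := ((hb s hs 2 (by norm_num) x).add
        (((hb s hs 1 (by norm_num) x).pow 2).const_mul (distF μ s))).const_mul (-(zetaFn β s / 2))
      refine HasDerivAt.congr_deriv h ?_
      push_cast
      ring)
    cG1
  have d2 := mixed_partials (u := fun s x => iteratedDeriv 1 (Φ μ s) x)
    (ux := fun s x => iteratedDeriv 2 (Φ μ s) x)
    (G := fun s x => -(zetaFn β s / 2) * (iteratedDeriv 3 (Φ μ s) x + distF μ s *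
        (2 * (iteratedDeriv 1 (Φ μ s) x * iteratedDeriv 2 (Φ μ s) x))))
    (Gx := fun s x => -(zetaFn β s / 2) * (iteratedDeriv 4 (Φ μ s) x + distF μ s *
        (2 * (iteratedDeriv 2 (Φ μ s) x * iteratedDeriv 2 (Φ μ s) x +
          iteratedDeriv 1 (Φ μ s) x * iteratedDeriv 3 (Φ μ s) x))))
    d1
    (fun s hs x => hb s hs 1 (by norm_num) x)
    (fun s hs x => by
      have h := ((hb s hs 3 (by norm_num) x).add
        ((((hb s hs 1 (by norm_num) x).mul (hb s hs 2 (by norm_num) x)).const_mul 2).const_mul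
          (distF μ s))).const_mul (-(zetaFn β s / 2))
      exact h)
    cG2
  have e : ∀ (f : ℝ → ℝ) (m j : ℕ),
      iteratedDeriv m (iteratedDeriv j f) = iteratedDeriv (m + j) f := by
    intro f m j
    simp only [iteratedDeriv_eq_iterate, Function.iterate_add_apply]
  refine ⟨⟨_, hd, cG0, fun s hs => ?_, c2⟩, ?_, ⟨_, d2, cG2, fun s hs => ?_, ?_⟩, hterm, ?_⟩
  · simpa only [iteratedDeriv_zero] using (hN s hs).contDiff 0 (by norm_num)
  · have e1 : (fun s x => deriv (Φ μ s) x) = fun s x => iteratedDeriv 1 (Φ μ s) x := by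
      funext s x; rw [iteratedDeriv_one]
    rw [e1]
    refine ⟨_, d1, cG1, fun s hs => (hN s hs).contDiff 1 (by norm_num), ?_⟩
    refine c3.congr fun p hp => ?_
    exact congrFun (e (Φ μ p.1) 2 1) p.2
  · exact (hN s hs).contDiff 2 le_rfl
  · refine c4.congr fun p hp => ?_
    exact congrFun (e (Φ μ p.1) 2 2) p.2
  · intro s hs x
    have := hd x s ⟨hs.1, hs.2.le⟩
    rwa [iteratedDeriv_one] at this

end
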